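/- arXiv:2407.15644 — 6 statements merged into one kernel-verified Lean document; each statement's English description precedes it below -/
import Mathlib

section
/- Let d > 0 be squarefree with d ≠ 3, K = ℚ(√−d) ⊆ ℂ, M = K(ζ₃) ⊆ ℂ, and let {1, σ, τ, στ} = Gal(M/ℚ) with σ fixing ℚ(ζ₃) pointwise and τ fixing K pointwise. Let 𝔞 be an ideal of O_M coprime to 3 and suppose α, α′ ∈ O_K both satisfy 𝔞·τ(𝔞) = αO_M = α′O_M. Then (σ(α)/𝔞)_{M,3} = (σ(α′)/𝔞)_{M,3}; that is, the spin [𝔞] is independent of the choice of generator from O_K. -/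
open NumberField

/-- The cubic residue symbol `χ γ 𝔞 = (γ/𝔞)_{M,3}` on a ring of integers `R` containing a
primitive third root of unity `ζ`: on a prime `𝔮 ∤ 3` it is the unique element of
`{1, ζ, ζ²}` congruent to `γ^((N(𝔮)-1)/3)` mod `𝔮` (and `0` if `γ ∈ 𝔮`), and it is extended
completely multiplicatively to ideals coprime to `3`. -/
def IsCubicResidueSymbol {R : Type*} [CommRing R] (ζ : R) (χ : R → Ideal R → R) : Prop :=
  (∀ γ : R, ∀ 𝔮 : Ideal R, 𝔮.IsPrime → (3 : R) ∉ 𝔮 →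
    ((γ ∈ 𝔮 → χ γ 𝔮 = 0) ∧
     (γ ∉ 𝔮 → (χ γ 𝔮 = 1 ∨ χ γ 𝔮 = ζ ∨ χ γ 𝔮 = ζ ^ 2) ∧
        χ γ 𝔮 - γ ^ ((Nat.card (R ⧸ 𝔮) - 1) / 3) ∈ 𝔮))) ∧
  (∀ γ : R, χ γ ⊤ = 1) ∧
  (∀ γ : R, ∀ 𝔞 𝔟 : Ideal R, Ideal.span {(3 : R)} ⊔ 𝔞 = ⊤ → Ideal.span {(3 : R)} ⊔ 𝔟 = ⊤ →
    χ γ (𝔞 * 𝔟) = χ γ 𝔞 * χ γ 𝔟)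

theorem exists_rat_of_mem_adjoin_I_mul_sqrt (d : ℕ) {z : ℂ}
    (hz : z ∈ IntermediateField.adjoin ℚ {Complex.I * (Real.sqrt d : ℂ)}) :
    ∃ a b : ℚ, z = a + b * (Complex.I * (Real.sqrt d : ℂ)) := by
  have hsq : (Complex.I * (Real.sqrt d : ℂ)) ^ 2 = -(d : ℂ) := by
    have h : ((Real.sqrt d : ℂ)) ^ 2 = (d : ℂ) := by
      rw [← Complex.ofReal_pow, Real.sq_sqrt (Nat.cast_nonneg d)]
      simp
    rw [mul_pow, Complex.I_sq, h]
    ring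
  induction hz using IntermediateField.adjoin_induction with
  | mem x hx =>
    rw [Set.mem_singleton_iff] at hx
    exact ⟨0, 1, by simp [hx]⟩
  | algebraMap x => exact ⟨x, 0, by simp⟩
  | add x y _ _ hx hy =>
    obtain ⟨a, b, rfl⟩ := hx
    obtain ⟨a', b', rfl⟩ := hy
    exact ⟨a + a', b + b', by push_cast; ring⟩
  | mul x y _ _ hx hy =>
    obtain ⟨a, b, rfl⟩ := hx
    obtain ⟨a', b', rfl⟩ := hy
    exact ⟨a * a' - d * b * b', a * b' + a' * b, by
      push_cast; linear_combination (b * b' : ℂ) * hsq⟩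
  | inv x _ hx =>
    obtain ⟨a, b, rfl⟩ := hx
    by_cases h0 : (a : ℂ) + b * (Complex.I * (Real.sqrt d : ℂ)) = 0
    · exact ⟨0, 0, by simp [h0]⟩
    by_cases hn : a ^ 2 + d * b ^ 2 = 0
    · have ha : a = 0 := by
        nlinarith [sq_nonneg a,
          mul_nonneg (Nat.cast_nonneg d : (0 : ℚ) ≤ d) (sq_nonneg b)]
      subst ha
      have : (d : ℚ) * b ^ 2 = 0 := by simpa using hn
      rcases mul_eq_zero.mp this with h | h
      · have : d = 0 := by exact_mod_cast h
        subst this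
        simp at h0
      · have : b = 0 := by simpa using h
        subst this
        simp at h0
    · refine ⟨a / (a ^ 2 + d * b ^ 2), -b / (a ^ 2 + d * b ^ 2), ?_⟩
      have hn' : (a : ℂ) ^ 2 + d * b ^ 2 ≠ 0 := by exact_mod_cast hn
      refine inv_eq_of_mul_eq_one_right ?_
      push_cast
      simp only [div_eq_mul_inv]
      linear_combination mul_inv_cancel₀ hn' - (b : ℂ) ^ 2 * ((a : ℂ) ^ 2 + d * b ^ 2)⁻¹ * hsq

theorem Rat.exists_int_of_isIntegral_complex {q : ℚ} (h : IsIntegral ℤ (q : ℂ)) :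
    ∃ n : ℤ, q = n := by
  have h' : IsIntegral ℤ (algebraMap ℚ ℂ q) := by simpa using h
  rw [isIntegral_algebraMap_iff (algebraMap ℚ ℂ).injective] at h'
  obtain ⟨n, hn⟩ := IsIntegrallyClosed.isIntegral_iff.mp h'
  exact ⟨n, by simpa using hn.symm⟩

theorem Squarefree.eq_three_of_mul_sq_eq_three {d : ℕ} (hd : Squarefree d) {r : ℚ}
    (h : (d : ℚ) * r ^ 2 = 3) : d = 3 := by
  have hsq : IsSquare ((3 * d : ℕ) : ℚ) := ⟨d * r, by push_cast; linear_combination -(d : ℚ) * h⟩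
  rw [Rat.isSquare_natCast_iff] at hsq
  obtain ⟨m, hm⟩ := hsq
  have h3 : 3 ∣ m := by
    have : 3 ∣ m * m := ⟨d, hm.symm⟩
    rcases (Nat.prime_three.dvd_mul).mp this with h | h <;> exact h
  obtain ⟨k, rfl⟩ := h3
  have hdk : d = k * k * 3 := by nlinarith
  have hk := hd k ⟨3, hdk⟩
  rw [Nat.isUnit_iff] at hk
  subst hk
  simpa using hdk

/-- The integral units of an imaginary quadratic field other than `ℚ(√-3)` are fourth roots
of unity. -/
theorem pow_four_eq_one_of_mem_adjoin_I_mul_sqrt {d : ℕ} (hd : Squarefree d) (hd3 : d ≠ 3)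
    {u v : ℂ} (hu : IsIntegral ℤ u) (hv : IsIntegral ℤ v) (huv : u * v = 1)
    (hmem : u ∈ IntermediateField.adjoin ℚ {Complex.I * (Real.sqrt d : ℂ)}) : u ^ 4 = 1 := by
  obtain ⟨a, b, hab⟩ := exists_rat_of_mem_adjoin_I_mul_sqrt d hmem
  have hsq : ((Real.sqrt d : ℂ)) ^ 2 = (d : ℂ) := by
    rw [← Complex.ofReal_pow, Real.sq_sqrt (Nat.cast_nonneg d)]
    simp
  have hconj : (starRingEnd ℂ) u = a - b * (Complex.I * (Real.sqrt d : ℂ)) := by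
    simp [hab]
    ring
  have hint : ∀ {z : ℂ}, IsIntegral ℤ z → IsIntegral ℤ ((starRingEnd ℂ) z) := fun hz =>
    hz.map ((starRingEnd ℂ).toIntAlgHom)
  have hnorm : u * (starRingEnd ℂ) u = ((a ^ 2 + d * b ^ 2 : ℚ) : ℂ) := by
    rw [hconj, hab]
    push_cast
    linear_combination -(b : ℂ) ^ 2 * Complex.I ^ 2 * hsq - (b : ℂ) ^ 2 * d * Complex.I_sq
  have htrace : u + (starRingEnd ℂ) u = ((2 * a : ℚ) : ℂ) := by
    rw [hconj, hab]
    push_cast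
    ring
  have hvv : (v * (starRingEnd ℂ) v) * (u * (starRingEnd ℂ) u) = 1 := by
    have h := congrArg (starRingEnd ℂ) huv
    rw [map_mul, map_one] at h
    linear_combination (starRingEnd ℂ u * starRingEnd ℂ v) * huv + h
  have hvnorm : v * (starRingEnd ℂ) v = (((a ^ 2 + d * b ^ 2)⁻¹ : ℚ) : ℂ) := by
    rw [hnorm] at hvv
    rw [Rat.cast_inv]
    exact eq_inv_of_mul_eq_one_left hvv
  obtain ⟨n, hn⟩ := Rat.exists_int_of_isIntegral_complex (hnorm ▸ hu.mul (hint hu))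
  obtain ⟨m, hm⟩ := Rat.exists_int_of_isIntegral_complex (hvnorm ▸ hv.mul (hint hv))
  obtain ⟨t, ht⟩ := Rat.exists_int_of_isIntegral_complex (htrace ▸ hu.add (hint hu))
  have hdb : 0 ≤ (d : ℚ) * b ^ 2 := by positivity
  have hn0 : 0 ≤ n := by
    have : (0 : ℚ) ≤ n := by rw [← hn]; positivity
    exact_mod_cast this
  have hmn : m * n = 1 := by
    have h : (((m * n : ℤ) : ℚ) : ℂ) = ((1 : ℚ) : ℂ) := by
      rw [hnorm, hvnorm, hn, ← hn, hm, hn] at hvv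
      push_cast at hvv ⊢
      exact hvv
    exact_mod_cast h
  have hn1 : n = 1 := Int.eq_one_of_mul_eq_one_left hn0 hmn
  subst hn1
  rw [hn] at hnorm
  rw [ht] at htrace
  push_cast at hnorm htrace hn
  have hquad : u ^ 2 - t * u + 1 = 0 := by
    linear_combination u * htrace - hnorm
  have ha : a = t / 2 := by linarith
  have htt : t ^ 2 ≤ 4 := by
    have : (t : ℚ) ^ 2 ≤ 4 := by rw [ha] at hn; nlinarith
    exact_mod_cast this
  have h1 : t ≤ 2 := by nlinarith
  have h2 : -2 ≤ t := by nlinarith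
  have hthree : t ^ 2 ≠ 1 := fun h => hd3 <| hd.eq_three_of_mul_sq_eq_three (r := 2 * b) <| by
    have h' : (t : ℚ) ^ 2 = 1 := by exact_mod_cast h
    rw [ha] at hn
    linear_combination 4 * hn - h'
  interval_cases t
  · have h : (u + 1) ^ 2 = 0 := by push_cast at hquad; linear_combination hquad
    have : u = -1 := eq_neg_of_add_eq_zero_left (by simpa using h)
    rw [this]; norm_num
  · simp at hthree
  · push_cast at hquad
    linear_combination (u ^ 2 - 1) * hquad
  · simp at hthree
  · have h : (u - 1) ^ 2 = 0 := by push_cast at hquad; linear_combination hquad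
    have : u = 1 := sub_eq_zero.mp (by simpa using h)
    rw [this]; norm_num

section ResidueSymbol

variable {R : Type*} [CommRing R] {ζ : R} {𝔮 : Ideal R}

theorem one_sub_notMem_of_three_notMem [𝔮.IsPrime] (hζ : ζ ^ 2 + ζ + 1 = 0)
    (h3 : (3 : R) ∉ 𝔮) : 1 - ζ ∉ 𝔮 := fun h => h3 <| by
  have : (3 : R) = (2 + ζ) * (1 - ζ) := by linear_combination hζ
  rw [this]
  exact 𝔮.mul_mem_left _ h

theorem three_dvd_card_quotient_sub_one [𝔮.IsMaximal] [Finite (R ⧸ 𝔮)]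
    (hζ : ζ ^ 2 + ζ + 1 = 0) (h3 : (3 : R) ∉ 𝔮) : 3 ∣ Nat.card (R ⧸ 𝔮) - 1 := by
  let _ := Ideal.Quotient.field 𝔮
  have hprim : orderOf (Ideal.Quotient.mk 𝔮 ζ) = 3 := by
    refine orderOf_eq_prime ?_ ?_
    · rw [← map_pow, show ζ ^ 3 = 1 by linear_combination (ζ - 1) * hζ, map_one]
    · intro h
      refine one_sub_notMem_of_three_notMem hζ h3 ?_
      rw [← Ideal.Quotient.eq_zero_iff_mem, map_sub, h, map_one, sub_self]
  have := Fintype.ofFinite (R ⧸ 𝔮)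
  rw [← hprim, Nat.card_eq_fintype_card]
  refine orderOf_dvd_of_pow_eq_one (FiniteField.pow_card_sub_one_eq_one _ ?_)
  intro h0
  rw [h0, orderOf_eq_zero_iff'.mpr] at hprim
  · simp at hprim
  · intro n hn; simp [hn.ne']

theorem eq_of_sub_mem_of_mem_cubeRoots [𝔮.IsPrime] (hζ : ζ ^ 2 + ζ + 1 = 0) (h3 : (3 : R) ∉ 𝔮)
    {x y : R} (hx : x = 1 ∨ x = ζ ∨ x = ζ ^ 2) (hy : y = 1 ∨ y = ζ ∨ y = ζ ^ 2)
    (hxy : x - y ∈ 𝔮) : x = y := by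
  have h1 := one_sub_notMem_of_three_notMem hζ h3
  have hcube : ζ ^ 3 = 1 := by linear_combination (ζ - 1) * hζ
  have key : ∀ c : R, c * (x - y) = 1 - ζ → x = y := fun c hc =>
    absurd (hc ▸ 𝔮.mul_mem_left c hxy) h1
  rcases hx with hx | hx | hx <;> rcases hy with hy | hy | hy <;> rw [hx, hy] at key ⊢
  · exact key 1 (by ring)
  · exact key (-ζ) (by linear_combination hcube)
  · exact key (-1) (by ring)
  · exact key (ζ ^ 2) (by linear_combination (1 - ζ) * hcube)
  · exact key ζ (by linear_combination hcube)
  · exact key (-ζ ^ 2) (by linear_combination (1 - ζ) * hcube)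

end ResidueSymbol

theorem Ideal.notMem_of_span_singleton_sup_eq_top {R : Type*} [CommRing R] {I : Ideal R}
    (hI : I ≠ ⊤) {x : R} (h : Ideal.span {x} ⊔ I = ⊤) : x ∉ I := fun hx =>
  hI <| by rwa [sup_eq_right.mpr ((Ideal.span_singleton_le_iff_mem I).mpr hx)] at h

/-- Multiplying the argument by the cube of a unit does not change the cubic residue symbol. -/
theorem IsCubicResidueSymbol.mul_cube_eq {F : Type*} [Field F] [NumberField F] {ζ : 𝓞 F}
    (hζ : ζ ^ 2 + ζ + 1 = 0) {χ : 𝓞 F → Ideal (𝓞 F) → 𝓞 F} (hχ : IsCubicResidueSymbol ζ χ)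
    (γ w : 𝓞 F) (hw : IsUnit w) {𝔞 : Ideal (𝓞 F)} (h𝔞 : 𝔞 ≠ ⊥)
    (h3 : Ideal.span {(3 : 𝓞 F)} ⊔ 𝔞 = ⊤) : χ (γ * w ^ 3) 𝔞 = χ γ 𝔞 := by
  obtain ⟨hprime, htop, hmul⟩ := hχ
  induction 𝔞 using UniqueFactorizationMonoid.induction_on_prime with
  | h₁ => exact absurd rfl h𝔞
  | h₂ I hI =>
    rw [Ideal.isUnit_iff] at hI
    rw [hI, htop, htop]
  | h₃ I 𝔮 hI h𝔮 ih =>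
    have h3𝔮 : Ideal.span {(3 : 𝓞 F)} ⊔ 𝔮 = ⊤ :=
      top_le_iff.mp (h3 ▸ sup_le_sup_left Ideal.mul_le_left _)
    have h3I : Ideal.span {(3 : 𝓞 F)} ⊔ I = ⊤ :=
      top_le_iff.mp (h3 ▸ sup_le_sup_left Ideal.mul_le_right _)
    rw [hmul _ _ _ h3𝔮 h3I, hmul _ _ _ h3𝔮 h3I, ih hI h3I]
    congr 1
    have h𝔮p : 𝔮.IsPrime := Ideal.isPrime_of_prime h𝔮
    have h𝔮m : 𝔮.IsMaximal := h𝔮p.isMaximal h𝔮.ne_zero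
    have h3n : (3 : 𝓞 F) ∉ 𝔮 := Ideal.notMem_of_span_singleton_sup_eq_top h𝔮p.ne_top h3𝔮
    have hwn : w ∉ 𝔮 := fun h => h𝔮p.ne_top (𝔮.eq_top_of_isUnit_mem h hw)
    by_cases hγ : γ ∈ 𝔮
    · rw [(hprime γ 𝔮 h𝔮p h3n).1 hγ, (hprime _ 𝔮 h𝔮p h3n).1 (𝔮.mul_mem_right _ hγ)]
    · have hγw : γ * w ^ 3 ∉ 𝔮 := fun h =>
        (h𝔮p.mem_or_mem h).elim hγ fun h => hwn (h𝔮p.mem_of_pow_mem _ h)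
      obtain ⟨hx, hx'⟩ := (hprime γ 𝔮 h𝔮p h3n).2 hγ
      obtain ⟨hy, hy'⟩ := (hprime _ 𝔮 h𝔮p h3n).2 hγw
      refine eq_of_sub_mem_of_mem_cubeRoots hζ h3n hy hx ?_
      have : Finite (𝓞 F ⧸ 𝔮) := Ideal.finiteQuotientOfFreeOfNeBot 𝔮 h𝔮.ne_zero
      have hdvd := three_dvd_card_quotient_sub_one hζ h3n
      let _ := Ideal.Quotient.field 𝔮
      have := Fintype.ofFinite (𝓞 F ⧸ 𝔮)
      have hw1 : Ideal.Quotient.mk 𝔮 w ^ (Nat.card (𝓞 F ⧸ 𝔮) - 1) = 1 := by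
        rw [Nat.card_eq_fintype_card]
        exact FiniteField.pow_card_sub_one_eq_one _
          fun h => hwn (Ideal.Quotient.eq_zero_iff_mem.mp h)
      rw [← Ideal.Quotient.eq_zero_iff_mem, map_sub, sub_eq_zero] at hx' hy' ⊢
      rw [hx', hy', mul_pow, ← pow_mul, Nat.mul_div_cancel' hdvd, map_mul, map_pow _ w, hw1,
        mul_one]

/-- **Independence of the spin on the chosen generator** (Section 3.2 of the paper).
With `K = ℚ(√-d)` (`d > 0` squarefree, `d ≠ 3`), `M = K(ζ₃)`, `Gal(M/ℚ) = {1, σ, τ, στ}`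
(`σ` fixing `ℚ(ζ₃)`, `τ` fixing `K`), if `𝔞` is an ideal of `O_M` coprime to `3` and
`α, α' ∈ O_K` both satisfy `𝔞·τ(𝔞) = αO_M = α'O_M`, then
`(σ(α)/𝔞)_{M,3} = (σ(α')/𝔞)_{M,3}`. -/
theorem stmt_6 (d : ℕ) (hd0 : 0 < d) (hdsf : Squarefree d) (hd3 : d ≠ 3)
    (K M : IntermediateField ℚ ℂ)
    (hK : K = IntermediateField.adjoin ℚ {Complex.I * (Real.sqrt d : ℂ)})
    (hM : M = IntermediateField.adjoin ℚ
      {Complex.I * (Real.sqrt d : ℂ), Complex.exp (2 * Real.pi * Complex.I / 3)})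
    [NumberField ↥M]
    (ζ : 𝓞 ↥M) (hζ : ((ζ : ↥M) : ℂ) = Complex.exp (2 * Real.pi * Complex.I / 3))
    (σ τ : 𝓞 ↥M ≃+* 𝓞 ↥M)
    (hσ : ∀ x : 𝓞 ↥M, ((x : ↥M) : ℂ) ∈
      IntermediateField.adjoin ℚ {Complex.exp (2 * Real.pi * Complex.I / 3)} → σ x = x)
    (hσne : σ ≠ RingEquiv.refl _)
    (hτ : ∀ x : 𝓞 ↥M, ((x : ↥M) : ℂ) ∈ K → τ x = x)
    (hτne : τ ≠ RingEquiv.refl _)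
    (χ : 𝓞 ↥M → Ideal (𝓞 ↥M) → 𝓞 ↥M) (hχ : IsCubicResidueSymbol ζ χ)
    (𝔞 : Ideal (𝓞 ↥M)) (h𝔞3 : Ideal.span {(3 : 𝓞 ↥M)} ⊔ 𝔞 = ⊤)
    (α α' : 𝓞 ↥M) (hα : ((α : ↥M) : ℂ) ∈ K) (hα' : ((α' : ↥M) : ℂ) ∈ K)
    (hgen : 𝔞 * Ideal.map τ 𝔞 = Ideal.span {α})
    (hgen' : 𝔞 * Ideal.map τ 𝔞 = Ideal.span {α'}) :
    χ (σ α) 𝔞 = χ (σ α') 𝔞 := by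
  have hζ2 : ζ ^ 2 + ζ + 1 = 0 := by
    have hprim : IsPrimitiveRoot (Complex.exp (2 * Real.pi * Complex.I / 3)) 3 := by
      simpa using Complex.isPrimitiveRoot_exp 3 (by norm_num)
    have hsum := hprim.geom_sum_eq_zero (by norm_num)
    rw [← hζ] at hsum
    simp only [Finset.sum_range_succ, Finset.sum_range_zero] at hsum
    apply RingOfIntegers.ext
    apply Subtype.ext
    push_cast
    linear_combination hsum
  have hintC : ∀ x : 𝓞 M, IsIntegral ℤ ((x : M) : ℂ) := fun x =>
    (RingOfIntegers.isIntegral_coe x).map (M.val.restrictScalars ℤ)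
  have h𝔞0 : 𝔞 ≠ ⊥ := by
    rintro rfl
    rw [sup_bot_eq, Ideal.span_singleton_eq_top] at h𝔞3
    obtain ⟨v, hv⟩ := h𝔞3.exists_right_inv
    have hv' : (3 : ℂ) * ((v : M) : ℂ) = 1 := by
      have h := congrArg (M.val.toRingHom.comp (algebraMap (𝓞 M) M)) hv
      rw [map_mul, map_one, map_ofNat] at h
      exact h
    have hv3 : ((v : M) : ℂ) = ((1 / 3 : ℚ) : ℂ) := by
      push_cast
      linear_combination hv' / 3
    obtain ⟨n, hn⟩ := Rat.exists_int_of_isIntegral_complex (hv3 ▸ hintC v)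
    have h : 3 * n = 1 := by
      have : (3 * n : ℚ) = 1 := by rw [← hn]; norm_num
      exact_mod_cast this
    omega
  obtain ⟨u, hu⟩ : Associated α α' := by
    rw [← Ideal.span_singleton_eq_span_singleton, ← hgen, ← hgen']
  by_cases hα0 : α = 0
  · rw [← hu, hα0, zero_mul]
  have hαC : ((α : M) : ℂ) ≠ 0 := by
    intro h
    apply hα0
    apply RingOfIntegers.ext
    apply Subtype.ext
    simpa using h
  have huK : (((u : 𝓞 M) : M) : ℂ) ∈ K := by
    have h : (((u : 𝓞 M) : M) : ℂ) = ((α' : M) : ℂ) / ((α : M) : ℂ) := by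
      rw [eq_div_iff hαC, ← hu]
      push_cast
      ring
    rw [h]
    exact K.div_mem hα' hα
  have hu4 : (u : 𝓞 M) ^ 4 = 1 := by
    have h := pow_four_eq_one_of_mem_adjoin_I_mul_sqrt hdsf hd3 (hintC u)
      (hintC ((u⁻¹ : (𝓞 M)ˣ) : 𝓞 M))
      (by simp) (hK ▸ huK)
    apply RingOfIntegers.ext
    apply Subtype.ext
    push_cast
    exact h
  have hcube : σ α' = σ α * σ ((u : 𝓞 M) ^ 3) ^ 3 := by
    rw [← hu, ← map_pow, ← map_mul]
    congr 2
    linear_combination (-(u : 𝓞 M) ^ 5 - u) * hu4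
  rw [hcube]
  exact (hχ.mul_cube_eq hζ2 _ _ ((u.isUnit.pow 3).map σ) h𝔞0 h𝔞3).symm
end

section
/- Let K ⊆ ℂ be an imaginary quadratic field and let m ≥ 3 be an odd integer coprime to the number of roots of unity contained in K. Let p ≡ 1 (mod m) be a rational prime such that p = κ·κ̄ with κ ∈ O_K and κO_K ≠ κ̄O_K, where the bar denotes complex conjugation. Let M = K(ζ_m) and let 𝔭 be a prime ideal of O_M containing κ whose residue field O_M/𝔭 has exactly p elements. Set a = κ + κ̄ ∈ ℤ. Then a is an m-th power residue modulo p (i.e. there exists b ∈ ℤ with b^m ≡ a (mod p)) if and only if κ̄ is an m-th power in O_M/𝔭 (i.e. there exists γ ∈ O_M with γ^m ≡ κ̄ (mod 𝔭)). -/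
open NumberField

/-- **Power residues of `a_p` and the spin** (key equivalence in Proposition 2.2 of the
paper).  Let `K ⊆ ℂ` be imaginary quadratic, `m ≥ 3` odd and coprime to the number of
roots of unity in `K`, `p ≡ 1 (mod m)` a prime with `p = κκ̄`, `κO_K ≠ κ̄O_K`.  Let
`M = K(ζ_m)` and `𝔭` a degree-one prime of `O_M` containing `κ`.  Then `a = κ + κ̄ ∈ ℤ`
is an `m`-th power residue mod `p` iff `κ̄` is an `m`-th power in `O_M/𝔭`. -/
theorem stmt_7 (K : IntermediateField ℚ ℂ) [NumberField ↥K]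
    (hdeg : Module.finrank ℚ ↥K = 2) (him : ∃ x : ↥K, ((x : ℂ)).im ≠ 0)
    (m : ℕ) (hm3 : 3 ≤ m) (hmodd : Odd m)
    (hw : Nat.Coprime m (Nat.card {x : ↥K // ∃ n : ℕ, 0 < n ∧ x ^ n = 1}))
    (p : ℕ) (hp : p.Prime) (hp1 : p % m = 1)
    (κ κb : 𝓞 ↥K) (hconj : ((κb : ↥K) : ℂ) = starRingEnd ℂ ((κ : ↥K) : ℂ))
    (hfac : κ * κb = (p : 𝓞 ↥K))
    (hne : Ideal.span {κ} ≠ Ideal.span {κb})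
    (M : IntermediateField ℚ ℂ) (hKM : K ≤ M)
    (hM : M = K ⊔ IntermediateField.adjoin ℚ {Complex.exp (2 * Real.pi * Complex.I / m)})
    [NumberField ↥M]
    (𝔭 : Ideal (𝓞 ↥M)) (h𝔭 : 𝔭.IsPrime)
    (κM κbM : 𝓞 ↥M)
    (hκM : ((κM : ↥M) : ℂ) = ((κ : ↥K) : ℂ))
    (hκbM : ((κbM : ↥M) : ℂ) = ((κb : ↥K) : ℂ))
    (hκ𝔭 : κM ∈ 𝔭) (hcard : Nat.card (𝓞 ↥M ⧸ 𝔭) = p)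
    (a : ℤ) (ha : ((a : ↥K)) = (κ : ↥K) + (κb : ↥K)) :
    (∃ b : ZMod p, b ^ m = (a : ZMod p)) ↔ (∃ γ : 𝓞 ↥M, γ ^ m - κbM ∈ 𝔭) := by
  have haM : (a : 𝓞 ↥M) = κM + κbM := by
    apply RingOfIntegers.ext
    apply Subtype.ext
    have h := congrArg (fun x : ↥K ↦ (x : ℂ)) ha
    push_cast at h ⊢
    rw [hκM, hκbM]
    simpa using h
  have hak : ((a : ℤ) : 𝓞 ↥M ⧸ 𝔭) = Ideal.Quotient.mk 𝔭 κbM := by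
    rw [← map_intCast (Ideal.Quotient.mk 𝔭), haM, map_add,
      Ideal.Quotient.eq_zero_iff_mem.mpr hκ𝔭, zero_add]
  have : Finite (𝓞 ↥M ⧸ 𝔭) := Nat.finite_of_card_ne_zero (hcard ▸ hp.ne_zero)
  let _ := Fintype.ofFinite (𝓞 ↥M ⧸ 𝔭)
  let e := ZMod.ringEquivOfPrime (𝓞 ↥M ⧸ 𝔭) hp (Nat.card_eq_fintype_card.symm.trans hcard)
  rw [e.toEquiv.exists_congr_left, Ideal.Quotient.mk_surjective.exists]
  refine exists_congr fun γ ↦ ?_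
  rw [← Ideal.Quotient.eq, map_pow, ← hak, ← e.injective.eq_iff, map_pow, map_intCast]
  simp
end

section
/- Let m be a prime and K ⊆ ℚ̄ an imaginary quadratic field. Suppose the rational prime p splits completely in the m-governing field of K and in every finite abelian extension of K of exponent dividing m that is unramified at every nonzero prime ideal of O_K, and write pO_K = 𝔮·𝔮̄ with 𝔮 ≠ 𝔮̄. Let K^{(m)}(p) be the compositum inside ℚ̄ of all finite abelian extensions of K of exponent dividing m unramified at every nonzero prime of O_K not above p. Then for every cyclic Galois extension L/K of degree m in which 𝔮̄ is ramified and every other nonzero prime ideal of O_K is unramified: every prime of the ring of integers of K^{(m)}(p) above p has residue degree 1 over p if and only if every prime of O_L above 𝔮 has residue degree 1 over 𝔮. -/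
open NumberField
open scoped nonZeroDivisors

noncomputable section

/-- A rational prime `p` splits completely in a number field with ring of integers `R`:
every prime of `R` above `p` is unramified and has residue degree one. -/
def SplitsCompletelyIn (p : ℕ) (R : Type*) [CommRing R] : Prop :=
  ∀ P : Ideal R, P.IsPrime → (p : R) ∈ P →
    (p : R) ∉ P ^ 2 ∧ Function.Surjective (fun n : ℕ => (n : R ⧸ P))

/-- Every prime of `R` lying above `p` has residue degree one over `p`. -/
def ResidueDegreeOneAbove (p : ℕ) (R : Type*) [CommRing R] : Prop :=
  ∀ P : Ideal R, P.IsPrime → (p : R) ∈ P →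
    Function.Surjective (fun n : ℕ => (n : R ⧸ P))

/-- The map on rings of integers induced by the inclusion `K ⊆ L`. -/
def intMap (K : IntermediateField ℚ ℂ) (L : IntermediateField ↥K ℂ) :
    𝓞 ↥K →+* 𝓞 ↥L :=
  RingOfIntegers.mapRingHom (algebraMap ↥K ↥L)

/-- The prime `𝔮` of `O_K` is unramified in the extension `L` of `K`. -/
def UnramifiedAt (K : IntermediateField ℚ ℂ) (L : IntermediateField ↥K ℂ)
    (𝔮 : Ideal (𝓞 ↥K)) : Prop :=
  ∀ P : Ideal (𝓞 ↥L), P.IsPrime → Ideal.map (intMap K L) 𝔮 ≤ P →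
    ¬ Ideal.map (intMap K L) 𝔮 ≤ P ^ 2

/-- `L` is a finite abelian extension of `K` of exponent dividing `m`. -/
def IsAbelianExpM (K : IntermediateField ℚ ℂ) (m : ℕ)
    (L : IntermediateField ↥K ℂ) : Prop :=
  FiniteDimensional ↥K ↥L ∧ IsGalois ↥K ↥L ∧
  (∀ g h : ↥L ≃ₐ[↥K] ↥L, g * h = h * g) ∧ (∀ g : ↥L ≃ₐ[↥K] ↥L, g ^ m = AlgEquiv.refl)

/-- `L/K` is unramified at every nonzero prime of `O_K` not lying above `p`. -/
def UnramifiedOutside (K : IntermediateField ℚ ℂ) (p : ℕ)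
    (L : IntermediateField ↥K ℂ) : Prop :=
  ∀ 𝔮 : Ideal (𝓞 ↥K), 𝔮.IsPrime → 𝔮 ≠ ⊥ → (p : 𝓞 ↥K) ∉ 𝔮 → UnramifiedAt K L 𝔮

/-- `K^(m)(p)`: the compositum of all finite abelian extensions of `K` of exponent
dividing `m` that are unramified at every nonzero prime of `O_K` not above `p`. -/
def Kmp (K : IntermediateField ℚ ℂ) (m p : ℕ) : IntermediateField ↥K ℂ :=
  sSup {L | IsAbelianExpM K m L ∧ UnramifiedOutside K p L}

/-- `H_K^(m)`: the compositum of all finite abelian extensions of `K` of exponent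
dividing `m` unramified at every nonzero prime of `O_K`. -/
def Hm (K : IntermediateField ℚ ℂ) (m : ℕ) : IntermediateField ↥K ℂ :=
  sSup {L | IsAbelianExpM K m L ∧
    ∀ 𝔮 : Ideal (𝓞 ↥K), 𝔮.IsPrime → 𝔮 ≠ ⊥ → UnramifiedAt K L 𝔮}

/-- The `m`-governing field `K(ζ_m, ᵐ√V_∅)` of `K`, where
`V_∅ = {x ∈ K^× : xO_K is an m-th power of a fractional ideal}`. -/
def GoverningField (K : IntermediateField ℚ ℂ) [NumberField ↥K] (m : ℕ) :
    IntermediateField ↥K ℂ :=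
  IntermediateField.adjoin ↥K
    ({Complex.exp (2 * Real.pi * Complex.I / m)} ∪
     {y : ℂ | ∃ x : ↥K, x ≠ 0 ∧
        (∃ J : FractionalIdeal (𝓞 ↥K)⁰ ↥K,
          FractionalIdeal.spanSingleton (𝓞 ↥K)⁰ (x : ↥K) = J ^ m) ∧
        y ^ m = (x : ℂ)})

/-- `L/K` is a cyclic Galois extension of degree `m`. -/
def IsCyclicDeg (K : IntermediateField ℚ ℂ) (m : ℕ)
    (L : IntermediateField ↥K ℂ) : Prop :=
  IsGalois ↥K ↥L ∧ Module.finrank ↥K ↥L = m ∧ IsCyclic (↥L ≃ₐ[↥K] ↥L)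

/-- `L/K` is ramified at `𝔮` and unramified at every other nonzero prime of `O_K`. -/
def RamifiedExactlyAt (K : IntermediateField ℚ ℂ) (L : IntermediateField ↥K ℂ)
    (𝔮 : Ideal (𝓞 ↥K)) : Prop :=
  (∃ P : Ideal (𝓞 ↥L), P.IsPrime ∧ Ideal.map (intMap K L) 𝔮 ≤ P ^ 2) ∧
  (∀ 𝔯 : Ideal (𝓞 ↥K), 𝔯.IsPrime → 𝔯 ≠ ⊥ → 𝔯 ≠ 𝔮 → UnramifiedAt K L 𝔯)

section LyingOver

variable {R S : Type*} [CommRing R] [CommRing S] [Algebra R S] [Algebra.IsIntegral R S]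
  [FaithfulSMul R S]

theorem exists_prime_under_eq (P : Ideal R) [P.IsPrime] :
    ∃ Q : Ideal S, Q.IsPrime ∧ Q.under R = P := by
  obtain ⟨Q, -, hQ, hQP⟩ := Ideal.exists_ideal_over_prime_of_isIntegral P (⊥ : Ideal S) (by
    rw [Ideal.comap_bot_of_injective _ (FaithfulSMul.algebraMap_injective R S)]
    exact bot_le)
  exact ⟨Q, hQ, hQP⟩

end LyingOver

section Hilbert

open Pointwise

theorem under_ne_bot {K F : Type*} [Field K] [Field F] [Algebra K F] [Algebra.IsIntegral K F]
    {P : Ideal (𝓞 F)} (hP : P ≠ ⊥) : P.under (𝓞 K) ≠ ⊥ :=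
  fun h ↦ hP (Ideal.eq_bot_of_comap_eq_bot h)

variable {K E F : Type*} [Field K] [Field E] [Field F] [NumberField K] [NumberField E]
  [NumberField F] [Algebra K E] [Algebra E F] [Algebra K F] [IsScalarTower K E F]

variable (K E F) in
theorem isGaloisGroup_fixingSubgroup_ringOfIntegers [IsGalois K F] :
    IsGaloisGroup (fixingSubgroup Gal(F/K) (Set.range (algebraMap E F))) (𝓞 E) (𝓞 F) := by
  have : FiniteDimensional K F := Module.Finite.right ℚ K F
  have := IsGaloisGroup.of_isScalarTower Gal(F/K) K F E
  exact IsGaloisGroup.of_isFractionRing _ (𝓞 E) (𝓞 F) E F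

theorem perfectField_residueField {p : Ideal (𝓞 K)} [p.IsPrime] (hp : p ≠ ⊥) :
    PerfectField p.ResidueField := by
  have : Finite (𝓞 K ⧸ p) := Ring.HasFiniteQuotients.finiteQuotient hp
  have : p.IsMaximal := Ideal.IsPrime.isMaximal ‹_› hp
  infer_instance

variable (P : Ideal (𝓞 F)) [P.IsPrime]

theorem card_inertia_eq_ramificationIdx {G : Type*} [Group G] [Finite G]
    [MulSemiringAction G (𝓞 F)] [IsGaloisGroup G (𝓞 K) (𝓞 F)] (hP : P ≠ ⊥) :
    Nat.card (P.inertia G) = P.ramificationIdx (𝓞 K) := by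
  have := perfectField_residueField (under_ne_bot (K := K) hP)
  rw [Ideal.card_inertia_eq_ramificationIdxIn (P.under (𝓞 K)) P,
    Ideal.ramificationIdxIn_eq_ramificationIdx (P.under (𝓞 K)) P G]

theorem card_stabilizer_eq_card_inertia_mul_inertiaDeg {G : Type*} [Group G] [Finite G]
    [MulSemiringAction G (𝓞 F)] [IsGaloisGroup G (𝓞 K) (𝓞 F)] (hP : P ≠ ⊥) :
    Nat.card (MulAction.stabilizer G P) = Nat.card (P.inertia G) * P.inertiaDeg (𝓞 K) := by
  have := perfectField_residueField (under_ne_bot (K := K) hP)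
  rw [Ideal.card_stabilizer_eq_card_inertia_mul_finrank (P.under (𝓞 K)) P]

theorem inertia_le_fixingSubgroup_iff [IsGalois K F] (hP : P ≠ ⊥) :
    P.inertia Gal(F/K) ≤ fixingSubgroup Gal(F/K) (Set.range (algebraMap E F)) ↔
      (P.under (𝓞 E)).ramificationIdx (𝓞 K) = 1 := by
  set H := fixingSubgroup Gal(F/K) (Set.range (algebraMap E F))
  have hH : IsGaloisGroup H (𝓞 E) (𝓞 F) := isGaloisGroup_fixingSubgroup_ringOfIntegers K E F
  have hG := card_inertia_eq_ramificationIdx (K := K) P (G := Gal(F/K)) hP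
  have hE := card_inertia_eq_ramificationIdx (K := E) P (G := H) hP
  have ht := Ideal.ramificationIdx_tower (R := 𝓞 K) (P.under (𝓞 E)) P
  have hcard : Nat.card (P.inertia H) = Nat.card (P.inertia Gal(F/K) ⊓ H : Subgroup _) := by
    rw [← AddSubgroup.inertia_map_subtype, Nat.card_congr (Subgroup.equivMapOfInjective _ _
      H.subtype_injective).toEquiv]
  have hpos : 0 < P.ramificationIdx (𝓞 E) := Ideal.ramificationIdx_pos P (𝓞 E)
  rw [← hE, hcard] at ht hpos
  rw [← hG] at ht
  constructor
  · intro h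
    rw [inf_eq_left.mpr h] at ht hpos
    exact Nat.eq_of_mul_eq_mul_right hpos (by rw [← ht, one_mul])
  · intro h
    rw [h, one_mul] at ht
    exact inf_eq_left.mp (Subgroup.eq_of_le_of_card_ge inf_le_left ht.le)

theorem stabilizer_le_fixingSubgroup [IsGalois K F] (hP : P ≠ ⊥)
    (he : (P.under (𝓞 E)).ramificationIdx (𝓞 K) = 1)
    (hf : (P.under (𝓞 E)).inertiaDeg (𝓞 K) = 1) :
    MulAction.stabilizer Gal(F/K) P ≤
      fixingSubgroup Gal(F/K) (Set.range (algebraMap E F)) := by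
  set H := fixingSubgroup Gal(F/K) (Set.range (algebraMap E F))
  have hH : IsGaloisGroup H (𝓞 E) (𝓞 F) := isGaloisGroup_fixingSubgroup_ringOfIntegers K E F
  have hG := card_stabilizer_eq_card_inertia_mul_inertiaDeg (K := K) P (G := Gal(F/K)) hP
  have hE := card_stabilizer_eq_card_inertia_mul_inertiaDeg (K := E) P (G := H) hP
  rw [card_inertia_eq_ramificationIdx (K := K) P hP,
    Ideal.ramificationIdx_tower (R := 𝓞 K) (P.under (𝓞 E)) P,
    Ideal.inertiaDeg_tower (R := 𝓞 K) (P.under (𝓞 E)) P, he, hf, one_mul, one_mul,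
    ← card_inertia_eq_ramificationIdx (K := E) P (G := H) hP, ← hE] at hG
  have hmap : (MulAction.stabilizer H P).map H.subtype = MulAction.stabilizer Gal(F/K) P ⊓ H := by
    ext g
    simp only [Subgroup.mem_map, Subgroup.mem_inf]
    exact ⟨fun ⟨x, hx, h⟩ ↦ h ▸ ⟨hx, x.2⟩, fun ⟨hg, hg'⟩ ↦ ⟨⟨g, hg'⟩, hg, rfl⟩⟩
  rw [Nat.card_congr (Subgroup.equivMapOfInjective _ _ H.subtype_injective).toEquiv] at hG
  replace hG := hG.trans (congrArg (fun S : Subgroup Gal(F/K) ↦ Nat.card S) hmap)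
  exact inf_eq_left.mp (Subgroup.eq_of_le_of_card_ge inf_le_left hG.le)

theorem inertiaDeg_eq_one_of_stabilizer_le_inertia [IsGalois K F] (hP : P ≠ ⊥)
    (h : MulAction.stabilizer Gal(F/K) P ≤ P.inertia Gal(F/K)) :
    P.inertiaDeg (𝓞 K) = 1 := by
  have hG := card_stabilizer_eq_card_inertia_mul_inertiaDeg (K := K) P (G := Gal(F/K)) hP
  rw [le_antisymm h (Ideal.inertia_le_stabilizer P)] at hG
  exact (Nat.eq_of_mul_eq_mul_left Nat.card_pos (by rw [mul_one, ← hG])).symm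

end Hilbert

section Tame

variable {B G : Type*} [CommRing B] [IsDedekindDomain B] [Group G] [MulSemiringAction G B]
  {P : Ideal B} [P.IsPrime]

/-- An element of finite order prime to the residue characteristic that acts trivially modulo `P`
and on `P / P ^ 2` acts trivially. -/
theorem smul_eq_of_tame {m : ℕ} (hm : (m : B) ∉ P) {g : G} (hgm : g ^ m = 1)
    (hg : ∀ x : B, g • x - x ∈ P) (hg' : ∀ x ∈ P, g • x - x ∈ P ^ 2) (x : B) : g • x = x := by
  by_cases hP : P = ⊥
  · simpa [hP, sub_eq_zero] using hg x
  have : P.IsMaximal := Ideal.IsPrime.isMaximal ‹_› hP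
  have key : ∀ n : ℕ, ∀ x ∈ P ^ n, g • x - x ∈ P ^ (n + 1) := by
    intro n
    induction n with
    | zero => intro x _; simpa using hg x
    | succ n ih =>
      intro x hx
      rw [pow_succ] at hx
      induction hx using Submodule.mul_induction_on' with
      | mem_mul_mem a ha b hb =>
        have h₁ : g • a - a ∈ P ^ (n + 1) := ih a ha
        have h₂ : g • b - b ∈ P ^ 2 := hg' b hb
        have h₃ : g • b ∈ P := by simpa using add_mem (Ideal.pow_le_self two_ne_zero h₂) hb
        have : g • (a * b) - a * b = (g • a - a) * g • b + a * (g • b - b) := by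
          rw [smul_mul']; ring
        rw [this, pow_succ P (n + 1)]
        refine add_mem (Ideal.mul_mem_mul h₁ h₃) ?_
        rw [← pow_succ, show n + 1 + 1 = n + 2 from rfl, pow_add]
        exact Ideal.mul_mem_mul ha h₂
      | add a _ b _ ha hb =>
        rw [smul_add, add_sub_add_comm]
        exact add_mem ha hb
  have hstep : ∀ n : ℕ, ∀ x : B, g • x - x ∈ P ^ n := by
    intro n
    induction n with
    | zero => simp
    | succ n ih =>
      intro x
      set y := g • x - x with hy
      have hi : ∀ i : ℕ, g ^ i • y - y ∈ P ^ (n + 1) ∧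
          g ^ i • x - x - i * y ∈ P ^ (n + 1) := by
        have hsm : ∀ i : ℕ, g ^ i • y ∈ P ^ n := by
          intro i
          have : g ^ i • y = g • (g ^ i • x) - g ^ i • x := by
            rw [hy, smul_sub, smul_smul, smul_smul, ← pow_succ, ← pow_succ']
          rw [this]; exact ih _
        intro i
        induction i with
        | zero => simp
        | succ i hi =>
          constructor
          · have := add_mem (key n _ (hsm i)) hi.1
            rwa [smul_smul, ← pow_succ', sub_add_sub_cancel] at this
          · have := add_mem hi.1 hi.2
            convert this using 1
            rw [hy, smul_sub, smul_smul, ← pow_succ]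
            push_cast
            ring
      have := (hi m).2
      rw [hgm, one_smul, sub_self, zero_sub, neg_mem_iff] at this
      exact (Ideal.IsPrime.mem_pow_mul P (by rwa [mul_comm] at this)).resolve_right hm
  have hbot := Ideal.iInf_pow_eq_bot_of_isDomain P (Ideal.IsPrime.ne_top ‹_›)
  have : g • x - x ∈ ⨅ i : ℕ, P ^ i := (Ideal.mem_iInf).mpr fun i ↦ hstep i x
  rwa [hbot, Ideal.mem_bot, sub_eq_zero] at this

theorem isCyclic_inertia_of_tame [FaithfulSMul G B] [Finite G] {m : ℕ} (hm : (m : B) ∉ P)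
    (hG : ∀ g : G, g ^ m = 1) : IsCyclic (P.inertia G) := by
  by_cases hP : P = ⊥
  · have : Subsingleton (P.inertia G) := by
      refine ⟨fun ⟨g, hg⟩ ⟨h, hh⟩ ↦ Subtype.ext (FaithfulSMul.eq_of_smul_eq_smul (α := B) ?_)⟩
      intro x
      have h₁ : g • x - x ∈ P := hg x
      have h₂ : h • x - x ∈ P := hh x
      rw [hP, Ideal.mem_bot, sub_eq_zero] at h₁ h₂
      rw [h₁, h₂]
    infer_instance
  obtain ⟨π, hπ, hπ'⟩ : ∃ π ∈ P, π ∉ P ^ 2 :=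
    SetLike.exists_of_lt (by
      simpa using (Ideal.pow_right_strictAnti P hP (Ideal.IsPrime.ne_top ‹_›)) one_lt_two)
  have hmem : ∀ (g : P.inertia G) (x : B), x ∈ P → (g : G) • x ∈ P := fun g x hx ↦ by
    have h₁ : (g : G) • x - x ∈ P := g.2 x
    simpa using add_mem h₁ hx
  have hmem2 : ∀ (g : P.inertia G) (x : B), x ∈ P ^ 2 → (g : G) • x ∈ P ^ 2 := fun g x hx ↦ by
    rw [pow_two] at hx ⊢
    induction hx using Submodule.mul_induction_on' with
    | mem_mul_mem a ha b hb =>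
      rw [smul_mul']
      exact Ideal.mul_mem_mul (hmem g a ha) (hmem g b hb)
    | add a _ b _ ha hb => rw [smul_add]; exact add_mem ha hb
  have hex : ∀ c ∈ P, ∃ d, c - π * d ∈ P ^ 2 := fun c hc ↦ by
    obtain ⟨d, e, he, h⟩ := Ideal.exists_mul_add_mem_pow_succ hP (i := 1) π c
      (by simpa using hπ) hπ' (by simpa using hc)
    exact ⟨d, by rw [← h]; simpa using he⟩
  have huniq : ∀ d, π * d ∈ P ^ 2 → d ∈ P := fun d hd ↦ by
    have hd' : d * π ∈ P ^ (1 + 1) := by rwa [mul_comm]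
    exact ((Ideal.IsPrime.mul_mem_pow P hd').resolve_right (fun h ↦ hπ' (by simpa using h)))
  choose u hu using fun g : P.inertia G ↦ hex _ (hmem g π hπ)
  let χ : P.inertia G →* B ⧸ P :=
    { toFun := fun g ↦ Ideal.Quotient.mk P (u g)
      map_one' := by
        rw [← map_one (Ideal.Quotient.mk P), Ideal.Quotient.eq]
        apply huniq
        have := hu 1
        rw [OneMemClass.coe_one, one_smul] at this
        rw [← neg_mem_iff]
        convert this using 1
        ring
      map_mul' := fun g h ↦ by
        rw [← map_mul, Ideal.Quotient.eq]
        apply huniq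
        have h₁ := hu (g * h)
        have h₂ := hmem2 g _ (hu h)
        have h₃ := hu g
        rw [Subgroup.coe_mul, mul_smul] at h₁
        rw [smul_sub, smul_mul'] at h₂
        have h₄ : ((g : G) • π) * ((g : G) • u h - u h) ∈ P ^ 2 := by
          rw [pow_two]
          exact Ideal.mul_mem_mul (hmem g π hπ) (g.2 (u h))
        convert sub_mem (add_mem h₂ (add_mem h₄ (Ideal.mul_mem_right (u h) _ h₃))) h₁ using 1
        ring }
  refine isCyclic_of_injective_ringHom χ ((injective_iff_map_eq_one χ).mpr fun g hg ↦ ?_)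
  have hg1 : u g - 1 ∈ P := by
    rw [← Ideal.Quotient.eq, map_one]
    exact hg
  refine Subtype.ext (FaithfulSMul.eq_of_smul_eq_smul (α := B) fun x ↦ ?_)
  rw [OneMemClass.coe_one, one_smul]
  refine smul_eq_of_tame hm (hG g) g.2 (fun x hx ↦ ?_) x
  obtain ⟨d, hd⟩ := hex x hx
  have h₁ := hmem2 g _ hd
  rw [smul_sub, smul_mul'] at h₁
  have h₂ : ((g : G) • π) * ((g : G) • d - d) ∈ P ^ 2 := by
    rw [pow_two]
    exact Ideal.mul_mem_mul (hmem g π hπ) (g.2 d)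
  have h₃ : π * (u g - 1) ∈ P ^ 2 := by
    rw [pow_two]
    exact Ideal.mul_mem_mul hπ hg1
  convert sub_mem (add_mem h₁ (add_mem h₂ (add_mem (Ideal.mul_mem_right d _ (hu g))
    (Ideal.mul_mem_right d _ h₃)))) hd using 1
  ring

end Tame

section Unramified

theorem unramifiedAt_iff {K : IntermediateField ℚ ℂ} [NumberField K] {E : IntermediateField K ℂ}
    [NumberField E] {𝔯 : Ideal (𝓞 K)} (h𝔯 : 𝔯.IsPrime) (h𝔯₀ : 𝔯 ≠ ⊥) :
    UnramifiedAt K E 𝔯 ↔ ∀ P : Ideal (𝓞 E), P.IsPrime → P.under (𝓞 K) = 𝔯 →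
      P.ramificationIdx (𝓞 K) = 1 := by
  have key : ∀ P : Ideal (𝓞 E), P.IsPrime → P.under (𝓞 K) = 𝔯 →
      (¬ Ideal.map (intMap K E) 𝔯 ≤ P ^ 2 ↔ P.ramificationIdx (𝓞 K) = 1) := by
    intro P hP h
    have : P.LiesOver 𝔯 := ⟨h.symm⟩
    rw [← Ideal.ramificationIdx'_eq_ramificationIdx 𝔯 P h𝔯₀]
    exact (not_congr (Ideal.ramificationIdx'_ne_one_iff (Ideal.map_le_iff_le_comap.mpr
      h.ge)).symm).trans not_not
  have hmax : 𝔯.IsMaximal := h𝔯.isMaximal h𝔯₀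
  constructor
  · exact fun h P hP hP' ↦ (key P hP hP').mp (h P hP (Ideal.map_le_iff_le_comap.mpr hP'.ge))
  · intro h P hP hP'
    have hu : P.under (𝓞 K) = 𝔯 :=
      (hmax.eq_of_le (Ideal.IsPrime.ne_top inferInstance) (Ideal.map_le_iff_le_comap.mp hP')).symm
    exact (key P hP hu).mpr (h P hP hu)

theorem unramifiedAt_iff_inertia {K : IntermediateField ℚ ℂ} [NumberField K]
    {E F : IntermediateField K ℂ} [FiniteDimensional K F] [IsGalois K F] (h : E ≤ F)
    {𝔯 : Ideal (𝓞 K)} (h𝔯 : 𝔯.IsPrime) (h𝔯₀ : 𝔯 ≠ ⊥) :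
    UnramifiedAt K E 𝔯 ↔ ∀ P : Ideal (𝓞 F), P.IsPrime → P.under (𝓞 K) = 𝔯 →
      P.inertia Gal(F/K) ≤ fixingSubgroup Gal(F/K) (Set.range (IntermediateField.inclusion h)) := by
  let _ : Algebra E F := (IntermediateField.inclusion h).toRingHom.toAlgebra
  have : IsScalarTower K E F := .of_algebraMap_eq' rfl
  have : NumberField F := .of_module_finite K F
  have : FiniteDimensional K E := .of_injective (IntermediateField.inclusion h).toLinearMap
    (IntermediateField.inclusion h).injective
  have : NumberField E := .of_module_finite K E
  have hne : ∀ P : Ideal (𝓞 F), P.under (𝓞 K) = 𝔯 → P ≠ ⊥ := by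
    rintro P hP rfl
    exact h𝔯₀ (hP.symm.trans (Ideal.comap_bot_of_injective _
      (FaithfulSMul.algebraMap_injective (𝓞 K) (𝓞 F))))
  rw [unramifiedAt_iff h𝔯 h𝔯₀]
  constructor
  · intro H P hP hP'
    exact (inertia_le_fixingSubgroup_iff (K := K) (E := E) P (hne P hP')).mpr
      (H _ inferInstance ((Ideal.under_under P).trans hP'))
  · intro H P hP hP'
    obtain ⟨Q, hQ, hQP⟩ := exists_prime_under_eq (S := 𝓞 F) P
    have hQ' : Q.under (𝓞 K) = 𝔯 := by
      rw [← hP', ← Ideal.under_under (B := 𝓞 E) Q, hQP]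
    have := (inertia_le_fixingSubgroup_iff (K := K) (E := E) Q (hne Q hQ')).mp (H Q hQ hQ')
    rwa [hQP] at this

end Unramified

section Abelian

variable {k Ω : Type*} [Field k] [Field Ω] [Algebra k Ω] {E F : IntermediateField k Ω}

theorem mem_fixingSubgroup_range_inclusion (h : E ≤ F) {g : Gal(F/k)} :
    g ∈ fixingSubgroup Gal(F/k) (Set.range (IntermediateField.inclusion h)) ↔
      ∀ x : F, (x : Ω) ∈ E → g x = x := by
  rw [mem_fixingSubgroup_iff]
  exact ⟨fun H x hx ↦ H x ⟨⟨x, hx⟩, rfl⟩, by rintro H _ ⟨x, rfl⟩; exact H _ x.2⟩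

theorem exists_fixingSubgroup_eq [FiniteDimensional k F] (H : Subgroup Gal(F/k)) :
    ∃ (E : IntermediateField k Ω) (h : E ≤ F),
      fixingSubgroup Gal(F/k) (Set.range (IntermediateField.inclusion h)) = H := by
  refine ⟨IntermediateField.lift (IntermediateField.fixedField H),
    IntermediateField.lift_le _, ?_⟩
  ext g
  rw [mem_fixingSubgroup_range_inclusion]
  conv_rhs => rw [← IntermediateField.fixingSubgroup_fixedField H,
    IntermediateField.mem_fixingSubgroup_iff]
  simp only [IntermediateField.mem_lift]

end Abelian

section IsAbelianExpM

variable {K : IntermediateField ℚ ℂ} {m p : ℕ} {E F : IntermediateField K ℂ}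

theorem IsAbelianExpM.mono (hF : IsAbelianExpM K m F) (h : E ≤ F) : IsAbelianExpM K m E := by
  obtain ⟨h₁, h₂, h₃, h₄⟩ := hF
  let _ : Algebra E F := (IntermediateField.inclusion h).toRingHom.toAlgebra
  have : IsScalarTower K E F := .of_algebraMap_eq' rfl
  have : IsAbelianGalois K F := { is_comm := ⟨h₃⟩ }
  have hE : IsAbelianGalois K E := .tower_bot K E F
  refine ⟨.of_injective (IntermediateField.inclusion h).toLinearMap
    (IntermediateField.inclusion h).injective, inferInstance, hE.is_comm.comm, fun g ↦ ?_⟩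
  obtain ⟨σ, rfl⟩ := AlgEquiv.restrictNormalHom_surjective (F := K) (K₁ := E) F g
  rw [← map_pow, h₄]
  exact map_one (AlgEquiv.restrictNormalHom E)

theorem IsAbelianExpM.apply_eq (hE : IsAbelianExpM K m E) (h : E ≤ F) (g g' : Gal(F/K)) {x : F}
    (hx : (x : ℂ) ∈ E) : (g * g') x = (g' * g) x ∧ (g ^ m) x = x := by
  obtain ⟨h₁, h₂, h₃, h₄⟩ := hE
  let _ : Algebra E F := (IntermediateField.inclusion h).toRingHom.toAlgebra
  have : IsScalarTower K E F := .of_algebraMap_eq' rfl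
  have key (σ : Gal(F/K)) : σ x = algebraMap E F (AlgEquiv.restrictNormalHom E σ ⟨x, hx⟩) :=
    (AlgEquiv.restrictNormal_commutes σ E ⟨x, hx⟩).symm
  constructor
  · rw [key, key, map_mul, map_mul, h₃]
  · rw [key, map_pow, h₄]
    rfl

theorem eq_one_of_fixes_sup {k Ω : Type*} [Field k] [Field Ω] [Algebra k Ω]
    {E F : IntermediateField k Ω} {g : Gal((E ⊔ F : IntermediateField k Ω)/k)}
    (h₁ : ∀ x : ↥(E ⊔ F), (x : Ω) ∈ E → g x = x) (h₂ : ∀ x : ↥(E ⊔ F), (x : Ω) ∈ F → g x = x) :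
    g = 1 := by
  have hle : E ⊔ F ≤
      IntermediateField.lift (IntermediateField.fixedField (Subgroup.zpowers g)) := by
    have key : ∀ x : ↥(E ⊔ F), g x = x →
        (x : Ω) ∈ IntermediateField.lift (IntermediateField.fixedField (Subgroup.zpowers g)) := by
      intro x hx
      rw [IntermediateField.mem_lift, IntermediateField.mem_fixedField_iff]
      exact fun f hf ↦ (Subgroup.zpowers_le (H := MulAction.stabilizer _ x)).mpr hx hf
    exact sup_le (fun x hx ↦ key ⟨x, le_sup_left (a := E) hx⟩ (h₁ _ hx))
      (fun x hx ↦ key ⟨x, le_sup_right (a := E) hx⟩ (h₂ _ hx))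
  ext x
  have := (IntermediateField.mem_lift x).mp (hle x.2)
  rw [IntermediateField.mem_fixedField_iff] at this
  rw [this g (Subgroup.mem_zpowers g), AlgEquiv.one_apply]

theorem IsAbelianExpM.sup (hE : IsAbelianExpM K m E) (hF : IsAbelianExpM K m F) :
    IsAbelianExpM K m (E ⊔ F) := by
  have := hE.1
  have := hF.1
  have := hE.2.1
  have := hF.2.1
  refine ⟨inferInstance, ?_, fun g h ↦ ?_, fun g ↦ ?_⟩
  · have := IntermediateField.normal_sup K ℂ E F
    exact {}
  · rw [← inv_mul_eq_one]
    have key (x : ↥(E ⊔ F)) (hx : (g * h) x = (h * g) x) : ((g * h)⁻¹ * (h * g)) x = x := by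
      rw [AlgEquiv.mul_apply, ← hx]
      exact AlgEquiv.symm_apply_apply (g * h) x
    exact eq_one_of_fixes_sup (fun x hx ↦ key x (hE.apply_eq le_sup_left g h hx).1)
      (fun x hx ↦ key x (hF.apply_eq le_sup_right g h hx).1)
  · exact eq_one_of_fixes_sup (fun x hx ↦ (hE.apply_eq le_sup_left g 1 hx).2)
      (fun x hx ↦ (hF.apply_eq le_sup_right g 1 hx).2)

theorem UnramifiedAt.mono [NumberField K] [FiniteDimensional K F] [IsGalois K F] (h : E ≤ F)
    {𝔯 : Ideal (𝓞 K)} (h𝔯 : 𝔯.IsPrime) (h𝔯₀ : 𝔯 ≠ ⊥) (hF : UnramifiedAt K F 𝔯) :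
    UnramifiedAt K E 𝔯 := by
  rw [unramifiedAt_iff_inertia h h𝔯 h𝔯₀]
  intro P hP hP' g hg
  have hg' := (unramifiedAt_iff_inertia le_rfl h𝔯 h𝔯₀).mp hF P hP hP' hg
  rw [mem_fixingSubgroup_range_inclusion] at hg' ⊢
  exact fun x _ ↦ hg' x x.2

theorem UnramifiedOutside.sup [NumberField K] (hE : IsAbelianExpM K m E)
    (hF : IsAbelianExpM K m F) (hE' : UnramifiedOutside K p E) (hF' : UnramifiedOutside K p F) :
    UnramifiedOutside K p (E ⊔ F) := by
  intro 𝔯 h𝔯 h𝔯₀ hp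
  have := (hE.sup hF).1
  have := (hE.sup hF).2.1
  rw [unramifiedAt_iff_inertia le_rfl h𝔯 h𝔯₀]
  intro P hP hP' g hg
  have h₁ := (unramifiedAt_iff_inertia le_sup_left h𝔯 h𝔯₀).mp (hE' 𝔯 h𝔯 h𝔯₀ hp) P hP hP' hg
  have h₂ := (unramifiedAt_iff_inertia le_sup_right h𝔯 h𝔯₀).mp (hF' 𝔯 h𝔯 h𝔯₀ hp) P hP hP' hg
  rw [mem_fixingSubgroup_range_inclusion] at h₁ h₂
  rw [eq_one_of_fixes_sup h₁ h₂]
  exact one_mem _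

end IsAbelianExpM

section Groups

variable {G : Type*} [Group G]

theorem Subgroup.inf_eq_bot_of_isCyclic {J H : Subgroup G} [IsCyclic J] {m : ℕ} (hm : m.Prime)
    (hJ : ∀ g : G, g ^ m = 1) (hJH : ¬ J ≤ H) : J ⊓ H = ⊥ := by
  have hdvd : Nat.card J ∣ m := by
    rw [← IsCyclic.exponent_eq_card]
    exact Monoid.exponent_dvd_of_forall_pow_eq_one fun g ↦ Subtype.ext (hJ g)
  rcases (Nat.dvd_prime hm).mp hdvd with h | h
  · rw [Subgroup.card_eq_one.mp h, bot_inf_eq]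
  · have : Fact (Nat.card J).Prime := ⟨h ▸ hm⟩
    rcases Subgroup.eq_bot_or_eq_top_of_prime_card (H.subgroupOf J) with h | h
    · rw [inf_comm, ← disjoint_iff]
      exact Subgroup.subgroupOf_eq_bot.mp h
    · exact absurd (Subgroup.subgroupOf_eq_top.mp h) hJH

theorem Subgroup.le_of_le_sup_of_inf_eq_bot {D I J H : Subgroup G} [I.Normal] (hD : D ≤ I ⊔ J)
    (hDH : D ≤ H) (hIH : I ≤ H) (hJH : J ⊓ H = ⊥) : D ≤ I := by
  intro d hd
  obtain ⟨i, hi, j, hj, rfl⟩ := Subgroup.mem_sup_of_normal_left.mp (hD hd)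
  have hj' : j ∈ J ⊓ H := ⟨hj, by simpa using mul_mem (inv_mem (hIH hi)) (hDH hd)⟩
  rw [hJH, Subgroup.mem_bot] at hj'
  rwa [hj', mul_one]

open Pointwise in
theorem Ideal.inertia_eq_of_under_eq {A B : Type*} [CommRing A] [CommRing B] [Algebra A B]
    [Finite G] [MulSemiringAction G B] [IsGaloisGroup G A B] (hG : ∀ g h : G, g * h = h * g)
    {P Q : Ideal B} [P.IsPrime] [Q.IsPrime] (h : P.under A = Q.under A) :
    P.inertia G = Q.inertia G := by
  have key : ∀ {P Q : Ideal B}, P.IsPrime → Q.IsPrime → P.under A = Q.under A →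
      P.inertia G ≤ Q.inertia G := by
    intro P Q hP hQ h g hg x
    have : P.LiesOver (Q.under A) := ⟨h.symm⟩
    obtain ⟨σ, rfl⟩ := Ideal.exists_smul_eq_of_isGaloisGroup (Q.under A) P Q G
    have h₁ : σ • (g • σ⁻¹ • x - σ⁻¹ • x) ∈ σ • P := Ideal.smul_mem_pointwise_smul _ _ _ (hg _)
    rwa [smul_sub, smul_smul, smul_smul, hG, smul_smul, inv_mul_cancel_left, mul_inv_cancel,
      one_smul] at h₁
  exact le_antisymm (key ‹_› ‹_› h) (key ‹_› ‹_› h.symm)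

end Groups

section Residue

variable {K F : Type*} [Field K] [Field F] [NumberField K] [NumberField F] [Algebra K F]

theorem inertiaDeg_eq_one_iff {P : Ideal (𝓞 F)} [P.IsPrime] (hP : P ≠ ⊥) :
    P.inertiaDeg (𝓞 K) = 1 ↔
      ∀ y : 𝓞 F, ∃ x : 𝓞 K, y - algebraMap (𝓞 K) (𝓞 F) x ∈ P := by
  have : P.IsMaximal := Ideal.IsPrime.isMaximal ‹_› hP
  have : (P.under (𝓞 K)).IsMaximal := Ideal.IsPrime.isMaximal inferInstance (under_ne_bot hP)
  rw [Ideal.inertiaDeg_eq_of_isMaximal (P.under (𝓞 K)) P]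
  let _ := Ideal.Quotient.field (P.under (𝓞 K))
  rw [Algebra.finrank_eq_one_iff_bijective_algebraMap, Function.Bijective,
    and_iff_right (FaithfulSMul.algebraMap_injective _ _)]
  constructor
  · intro h y
    obtain ⟨x, hx⟩ := h (Ideal.Quotient.mk P y)
    obtain ⟨x, rfl⟩ := Ideal.Quotient.mk_surjective x
    exact ⟨x, Ideal.Quotient.eq.mp hx.symm⟩
  · intro h y
    obtain ⟨y, rfl⟩ := Ideal.Quotient.mk_surjective y
    obtain ⟨x, hx⟩ := h y
    exact ⟨Ideal.Quotient.mk _ x, (Ideal.Quotient.eq.mpr hx).symm⟩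

end Residue

section Main

variable {K : IntermediateField ℚ ℂ} [NumberField K] {m p : ℕ} {𝔮 𝔮b : Ideal (𝓞 K)}

theorem eq_or_eq_of_natCast_mem (hp : p.Prime) (h𝔮 : 𝔮.IsPrime) (h𝔮b : 𝔮b.IsPrime)
    (hfac : 𝔮 * 𝔮b = Ideal.span {(p : 𝓞 K)}) {𝔯 : Ideal (𝓞 K)} (h𝔯 : 𝔯.IsPrime)
    (hp𝔯 : (p : 𝓞 K) ∈ 𝔯) : 𝔯 = 𝔮 ∨ 𝔯 = 𝔮b := by
  have hbot : 𝔮 * 𝔮b ≠ ⊥ := by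
    rw [hfac, Ne, Ideal.span_singleton_eq_bot]
    exact_mod_cast hp.ne_zero
  have hle : 𝔮 * 𝔮b ≤ 𝔯 := by rwa [hfac, Ideal.span_singleton_le_iff_mem]
  rcases h𝔯.mul_le.mp hle with h | h
  · have : 𝔮.IsMaximal := h𝔮.isMaximal (by rintro rfl; simp at hbot)
    exact .inl (this.eq_of_le h𝔯.ne_top h).symm
  · have : 𝔮b.IsMaximal := h𝔮b.isMaximal (by rintro rfl; simp at hbot)
    exact .inr (this.eq_of_le h𝔯.ne_top h).symm

theorem exists_sub_natCast_mem {R : Type*} [CommRing R] {P : Ideal R} :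
    Function.Surjective (fun n : ℕ ↦ (n : R ⧸ P)) ↔ ∀ y : R, ∃ n : ℕ, y - n ∈ P := by
  constructor
  · intro h y
    obtain ⟨n, hn⟩ := h (Ideal.Quotient.mk P y)
    exact ⟨n, Ideal.Quotient.eq.mp (by rw [map_natCast]; exact hn.symm)⟩
  · intro h y
    obtain ⟨y, rfl⟩ := Ideal.Quotient.mk_surjective y
    obtain ⟨n, hn⟩ := h y
    exact ⟨n, by rw [Ideal.Quotient.eq.mpr hn, map_natCast]⟩

open Pointwise in
theorem surjective_natCast_of_under_eq (hm : m.Prime) (hp : p.Prime) (hpm : p ≠ m)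
    (hHK : ∀ L : IntermediateField K ℂ, IsAbelianExpM K m L →
      (∀ 𝔮 : Ideal (𝓞 K), 𝔮.IsPrime → 𝔮 ≠ ⊥ → UnramifiedAt K L 𝔮) → SplitsCompletelyIn p (𝓞 L))
    (h𝔮 : 𝔮.IsPrime) (h𝔮b : 𝔮b.IsPrime) (hne : 𝔮 ≠ 𝔮b)
    (hfac : 𝔮 * 𝔮b = Ideal.span {(p : 𝓞 K)})
    (hres : Function.Surjective (fun n : ℕ ↦ (n : 𝓞 K ⧸ 𝔮)))
    {L : IntermediateField K ℂ} (hL : RamifiedExactlyAt K L 𝔮b)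
    (hLres : ∀ P : Ideal (𝓞 L), P.IsPrime → Ideal.map (intMap K L) 𝔮 ≤ P →
      ∀ y : 𝓞 L ⧸ P, ∃ x : 𝓞 K, Ideal.Quotient.mk P (intMap K L x) = y)
    {F : IntermediateField K ℂ} (hF : IsAbelianExpM K m F) (hF' : UnramifiedOutside K p F)
    (hLF : L ≤ F) {Q : Ideal (𝓞 F)} (hQ : Q.IsPrime) (hQ𝔮 : Q.under (𝓞 K) = 𝔮) :
    Function.Surjective (fun n : ℕ ↦ (n : 𝓞 F ⧸ Q)) := by
  have hpmem : (p : 𝓞 K) ∈ 𝔮 ∧ (p : 𝓞 K) ∈ 𝔮b := by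
    have : (p : 𝓞 K) ∈ 𝔮 * 𝔮b := by
      rw [hfac]
      exact Ideal.mem_span_singleton_self _
    exact ⟨(Ideal.mul_le_left : 𝔮 * 𝔮b ≤ 𝔮) this, (Ideal.mul_le_right : 𝔮 * 𝔮b ≤ 𝔮b) this⟩
  have hp0 : (p : 𝓞 K) ≠ 0 := Nat.cast_ne_zero.mpr hp.ne_zero
  have h𝔮₀ : 𝔮 ≠ ⊥ := fun h ↦ hp0 (by simpa [h] using hpmem.1)
  have h𝔮b₀ : 𝔮b ≠ ⊥ := fun h ↦ hp0 (by simpa [h] using hpmem.2)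
  have := hF.1
  have := hF.2.1
  have : NumberField F := .of_module_finite K F
  have hfaith : FaithfulSMul Gal(F/K) (𝓞 F) := IsGaloisGroup.faithful (𝓞 K)
  have hinj := FaithfulSMul.algebraMap_injective (𝓞 K) (𝓞 F)
  have hQ₀ : Q ≠ ⊥ := by
    rintro rfl
    exact h𝔮₀ (hQ𝔮.symm.trans (Ideal.comap_bot_of_injective _ hinj))
  obtain ⟨Q', hQ', hQ'𝔮b⟩ := exists_prime_under_eq (S := 𝓞 F) 𝔮b
  have hin : ∀ {P R : Ideal (𝓞 F)}, P.IsPrime → R.IsPrime → P.under (𝓞 K) = R.under (𝓞 K) →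
      P.inertia Gal(F/K) = R.inertia Gal(F/K) := fun _ _ h ↦
    Ideal.inertia_eq_of_under_eq (A := 𝓞 K) hF.2.2.1 h
  set I := Q.inertia Gal(F/K)
  set J := Q'.inertia Gal(F/K)
  have hnormal : I.Normal := ⟨fun n hn g ↦ by rwa [hF.2.2.1 g n, mul_inv_cancel_right]⟩
  -- the decomposition group is contained in `I ⊔ J`
  have hDIJ : MulAction.stabilizer Gal(F/K) Q ≤ I ⊔ J := by
    obtain ⟨E, hEF, hE⟩ := exists_fixingSubgroup_eq (I ⊔ J)
    have hEun : ∀ 𝔯 : Ideal (𝓞 K), 𝔯.IsPrime → 𝔯 ≠ ⊥ → UnramifiedAt K E 𝔯 := by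
      intro 𝔯 h𝔯 h𝔯₀
      by_cases hp𝔯 : (p : 𝓞 K) ∈ 𝔯
      · rw [unramifiedAt_iff_inertia hEF h𝔯 h𝔯₀, hE]
        intro P hP hP'
        rcases eq_or_eq_of_natCast_mem hp h𝔮 h𝔮b hfac h𝔯 hp𝔯 with h | h
        · rw [hin hP hQ (by rw [hP', h, hQ𝔮])]
          exact le_sup_left
        · rw [hin hP hQ' (by rw [hP', h, ← hQ'𝔮b])]
          exact le_sup_right
      · exact (hF' 𝔯 h𝔯 h𝔯₀ hp𝔯).mono hEF h𝔯 h𝔯₀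
    let _ : Algebra E F := (IntermediateField.inclusion hEF).toRingHom.toAlgebra
    have : IsScalarTower K E F := .of_algebraMap_eq' rfl
    have hEexp := hF.mono hEF
    have := hEexp.1
    have : NumberField E := .of_module_finite K E
    have hsplit := hHK E hEexp hEun (Q.under (𝓞 E)) inferInstance (by
      rw [Ideal.mem_comap, map_natCast, ← map_natCast (algebraMap (𝓞 K) (𝓞 F)),
        ← Ideal.mem_comap]
      exact hQ𝔮.ge hpmem.1)
    have h𝔮E : (Q.under (𝓞 E)).under (𝓞 K) = 𝔮 := (Ideal.under_under Q).trans hQ𝔮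
    have he := (unramifiedAt_iff h𝔮 h𝔮₀).mp (hEun 𝔮 h𝔮 h𝔮₀) (Q.under (𝓞 E)) inferInstance h𝔮E
    rw [← hE]
    refine stabilizer_le_fixingSubgroup (E := E) Q hQ₀ he
      ((inertiaDeg_eq_one_iff (under_ne_bot hQ₀)).mpr fun y ↦ ?_)
    obtain ⟨n, hn⟩ := exists_sub_natCast_mem.mp hsplit.2 y
    exact ⟨n, by rwa [map_natCast]⟩
  let _ : Algebra L F := (IntermediateField.inclusion hLF).toRingHom.toAlgebra
  have : IsScalarTower K L F := .of_algebraMap_eq' rfl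
  have := (hF.mono hLF).1
  have : NumberField L := .of_module_finite K L
  set H := fixingSubgroup Gal(F/K) (Set.range (IntermediateField.inclusion hLF))
  have hDH : MulAction.stabilizer Gal(F/K) Q ≤ H := by
    have h𝔮L : (Q.under (𝓞 L)).under (𝓞 K) = 𝔮 := (Ideal.under_under Q).trans hQ𝔮
    have he := (unramifiedAt_iff h𝔮 h𝔮₀).mp (hL.2 𝔮 h𝔮 h𝔮₀ hne) (Q.under (𝓞 L)) inferInstance h𝔮L
    refine stabilizer_le_fixingSubgroup (E := L) Q hQ₀ he
      ((inertiaDeg_eq_one_iff (under_ne_bot hQ₀)).mpr fun y ↦ ?_)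
    obtain ⟨x, hx⟩ := hLres (Q.under (𝓞 L)) inferInstance (Ideal.map_le_iff_le_comap.mpr h𝔮L.ge)
      (Ideal.Quotient.mk _ y)
    exact ⟨x, Ideal.Quotient.eq.mp hx.symm⟩
  have hJH : ¬ J ≤ H := by
    intro hJH
    obtain ⟨P, hP, hP'⟩ := hL.1
    refine (unramifiedAt_iff_inertia hLF h𝔮b h𝔮b₀).mpr (fun R hR hR' ↦ ?_) P hP
      (hP'.trans (Ideal.pow_le_self two_ne_zero)) hP'
    rwa [hin hR hQ' (by rw [hR', ← hQ'𝔮b])]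
  have hmQ' : (m : 𝓞 F) ∉ Q' := by
    intro hmem
    have hpQ' : (p : 𝓞 F) ∈ Q' := by
      rw [← map_natCast (algebraMap (𝓞 K) (𝓞 F)), ← Ideal.mem_comap]
      exact hQ'𝔮b.ge hpmem.2
    apply hQ'.ne_top
    rw [Ideal.eq_top_iff_one]
    obtain ⟨a, b, hab⟩ := (Nat.isCoprime_iff_coprime.mpr ((Nat.coprime_primes hp hm).mpr hpm))
    have := congrArg (Int.cast : ℤ → 𝓞 F) hab
    push_cast at this
    rw [← this]
    exact add_mem (Ideal.mul_mem_left _ _ hpQ') (Ideal.mul_mem_left _ _ hmem)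
  have hJ : IsCyclic J := isCyclic_inertia_of_tame hmQ' hF.2.2.2
  have hDI := Subgroup.le_of_le_sup_of_inf_eq_bot hDIJ hDH
    ((Ideal.inertia_le_stabilizer Q).trans hDH)
    (Subgroup.inf_eq_bot_of_isCyclic hm hF.2.2.2 hJH)
  have hdeg := (inertiaDeg_eq_one_iff hQ₀).mp (inertiaDeg_eq_one_of_stabilizer_le_inertia Q hQ₀ hDI)
  refine exists_sub_natCast_mem.mpr fun y ↦ ?_
  obtain ⟨x, hx⟩ := hdeg y
  obtain ⟨n, hn⟩ := exists_sub_natCast_mem.mp hres x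
  refine ⟨n, ?_⟩
  rw [← hQ𝔮, Ideal.mem_comap, map_sub, map_natCast] at hn
  simpa using add_mem hx hn

end Main

section Conjugation

variable {K : IntermediateField ℚ ℂ} {E E' : IntermediateField K ℂ} {m p : ℕ}

theorem IsAbelianExpM.of_ringEquiv (σ : K ≃+* K) (e : E ≃+* E')
    (he : ∀ x : K, e (algebraMap K E x) = algebraMap K E' (σ x)) (hE : IsAbelianExpM K m E) :
    IsAbelianExpM K m E' := by
  obtain ⟨h₁, h₂, h₃, h₄⟩ := hE
  have he' : (algebraMap K E').comp σ = (e : E →+* E').comp (algebraMap K E) :=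
    RingHom.ext fun x ↦ (he x).symm
  let φ : Gal(E'/K) →* Gal(E/K) :=
    { toFun := fun g ↦ AlgEquiv.ofRingEquiv (f := (e.trans g.toRingEquiv).trans e.symm) fun x ↦ by
        change e.symm (g (e (algebraMap K E x))) = algebraMap K E x
        rw [he, g.commutes, ← he, e.symm_apply_apply]
      map_one' := AlgEquiv.ext fun x ↦ e.symm_apply_apply x
      map_mul' := fun g h ↦ AlgEquiv.ext fun x ↦ by
        change e.symm (g (h (e x))) = e.symm (g (e (e.symm (h (e x)))))
        rw [e.apply_symm_apply] }
  have hφ : Function.Injective φ := fun g h hgh ↦ AlgEquiv.ext fun x ↦ by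
    have : e.symm (g (e (e.symm x))) = e.symm (h (e (e.symm x))) := DFunLike.congr_fun hgh (e.symm x)
    simpa using this
  refine ⟨.of_equiv_equiv σ e he', .of_equiv_equiv he', fun g h ↦ hφ ?_, fun g ↦ hφ ?_⟩
  · rw [map_mul, map_mul, h₃]
  · rw [map_pow, h₄]
    exact (map_one φ).symm

theorem UnramifiedOutside.of_ringEquiv (σ : K ≃+* K) (e : E ≃+* E')
    (he : ∀ x : K, e (algebraMap K E x) = algebraMap K E' (σ x)) (hE : UnramifiedOutside K p E) :
    UnramifiedOutside K p E' := by
  intro 𝔯 h𝔯 h𝔯₀ hp P hP hle hle2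
  let σ' : 𝓞 K ≃+* 𝓞 K := RingOfIntegers.mapRingEquiv σ
  let e' : 𝓞 E ≃+* 𝓞 E' := RingOfIntegers.mapRingEquiv e
  have he' : ∀ x : 𝓞 K, e' (intMap K E x) = intMap K E' (σ' x) := fun x ↦
    RingOfIntegers.ext (he x)
  have key : ∀ I : Ideal (𝓞 E'), Ideal.map (intMap K E') 𝔯 ≤ I →
      Ideal.map (intMap K E) (𝔯.comap σ') ≤ I.comap e' := by
    intro I hI
    rw [Ideal.map_le_iff_le_comap] at hI ⊢
    intro x hx
    rw [Ideal.mem_comap, Ideal.mem_comap, he']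
    exact hI hx
  have hpow : (P ^ 2).comap e' = P.comap e' ^ 2 := by
    rw [← Ideal.map_symm, ← Ideal.map_symm, Ideal.map_pow]
  refine hE (𝔯.comap σ') inferInstance ?_ ?_ (P.comap e') inferInstance (key P hle)
    (hpow ▸ key _ hle2)
  · rw [← Ideal.map_symm, Ne, Ideal.map_eq_bot_iff_of_injective σ'.symm.injective]
    exact h𝔯₀
  · rwa [Ideal.mem_comap, map_natCast]

open Pointwise in
theorem exists_conj [NumberField K] (hdeg : Module.finrank ℚ K = 2)
    (him : ∃ x : K, (x : ℂ).im ≠ 0) (hp : p.Prime) {𝔮 𝔮b : Ideal (𝓞 K)} (h𝔮 : 𝔮.IsPrime)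
    (h𝔮b : 𝔮b.IsPrime) (hne : 𝔮 ≠ 𝔮b) (hp𝔮 : (p : 𝓞 K) ∈ 𝔮) (hp𝔮b : (p : 𝓞 K) ∈ 𝔮b) :
    ∃ σ : K ≃+* K, (∀ x : K, (σ x : ℂ) = (starRingEnd ℂ) x) ∧
      ∀ x : 𝓞 K, x ∈ 𝔮 → RingOfIntegers.mapRingEquiv σ x ∈ 𝔮b := by
  have : Algebra.IsQuadraticExtension ℚ K := ⟨hdeg⟩
  have : IsGalois ℚ K := inferInstance
  let σ : Gal(K/ℚ) := AlgEquiv.restrictNormal (Complex.conjAe.restrictScalars ℚ) K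
  have hσ (x : K) : (σ x : ℂ) = (starRingEnd ℂ) x :=
    AlgEquiv.restrictNormal_commutes (Complex.conjAe.restrictScalars ℚ) K x
  have hσ1 : σ ≠ 1 := by
    intro h
    obtain ⟨x, hx⟩ := him
    have := hσ x
    rw [h, AlgEquiv.one_apply] at this
    exact hx (Complex.conj_eq_iff_im.mp this.symm)
  refine ⟨σ.toRingEquiv, hσ, ?_⟩
  have hcard : Nat.card Gal(K/ℚ) = 2 := by rw [IsGalois.card_aut_eq_finrank, hdeg]
  have hover : ∀ 𝔯 : Ideal (𝓞 K), 𝔯.IsPrime → (p : 𝓞 K) ∈ 𝔯 → 𝔯.LiesOver (Ideal.span {(p : ℤ)}) := by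
    intro 𝔯 h𝔯 h
    have hmax : (Ideal.span {(p : ℤ)}).IsMaximal :=
      PrincipalIdealRing.isMaximal_of_irreducible (Nat.prime_iff_prime_int.mp hp).irreducible
    refine ⟨hmax.eq_of_le (Ideal.IsPrime.ne_top inferInstance) ?_⟩
    rw [Ideal.span_singleton_le_iff_mem, Ideal.mem_comap, map_natCast]
    exact h
  have := hover 𝔮 h𝔮 hp𝔮
  have := hover 𝔮b h𝔮b hp𝔮b
  obtain ⟨g, hg⟩ := Ideal.exists_smul_eq_of_isGaloisGroup (Ideal.span {(p : ℤ)}) 𝔮 𝔮b Gal(K/ℚ)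
  have hg1 : g ≠ 1 := by
    rintro rfl
    exact hne (by rw [← hg, one_smul])
  obtain ⟨a, -, ha⟩ := (Nat.card_eq_two_iff' (1 : Gal(K/ℚ))).mp hcard
  intro x hx
  have : σ • x ∈ 𝔮b := by
    rw [← hg, ha g hg1, ← ha σ hσ1]
    exact Ideal.smul_mem_pointwise_smul _ _ _ hx
  exact this

end Conjugation

section ResidueDegree

variable {R S : Type*} [CommRing R] [CommRing S] [Algebra R S] [Algebra.IsIntegral R S]
  [FaithfulSMul R S]

variable (S) in
theorem ResidueDegreeOneAbove.of_isIntegral {p : ℕ} (h : ResidueDegreeOneAbove p S) :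
    ResidueDegreeOneAbove p R := by
  intro P hP hp
  obtain ⟨Q, hQ, rfl⟩ := exists_prime_under_eq (S := S) P
  rw [Ideal.mem_comap, map_natCast] at hp
  refine exists_sub_natCast_mem.mpr fun y ↦ ?_
  obtain ⟨n, hn⟩ := exists_sub_natCast_mem.mp (h Q hQ hp) (algebraMap R S y)
  exact ⟨n, by rwa [Ideal.mem_comap, map_sub, map_natCast]⟩

end ResidueDegree

section Governing

theorem IsPrimitiveRoot.natCast_mem_sq {R : Type*} [CommRing R] [IsDomain R] {m : ℕ}
    (hm : m.Prime) (hm2 : m ≠ 2) {ζ : R} (hζ : IsPrimitiveRoot ζ m) {P : Ideal R} [P.IsPrime]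
    (hmP : (m : R) ∈ P) : (m : R) ∈ P ^ 2 := by
  obtain ⟨r, hr⟩ := exists_add_pow_prime_eq hm (1 - ζ) ζ
  rw [sub_add_cancel, one_pow, hζ.pow_eq_one] at hr
  have h1 : 1 - ζ ∈ P := by
    refine Ideal.IsPrime.mem_of_pow_mem ‹_› m ?_
    rw [show (1 - ζ) ^ m = -(m * ((1 - ζ) * ζ * r)) by linear_combination -hr]
    exact neg_mem (Ideal.mul_mem_right _ _ hmP)
  have hfac : ∀ k : ℕ, 1 - ζ ^ (k + 1) ∈ P := fun k ↦
    Ideal.mem_of_dvd P (by simpa using sub_dvd_pow_sub_pow 1 ζ (k + 1)) h1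
  obtain ⟨n, rfl⟩ : ∃ n, m = n + 1 := ⟨m - 1, (Nat.sub_add_cancel hm.one_le).symm⟩
  have hn : 2 ≤ n := by have := hm.two_le; omega
  have := Ideal.prod_mem_prod (s := Finset.range n) (I := fun _ ↦ P) fun k _ ↦ hfac k
  rw [hζ.prod_one_sub_pow_eq_order, Finset.prod_const, Finset.card_range] at this
  rw [Nat.cast_succ]
  exact Ideal.pow_le_pow_right hn this

theorem two_mem_sq_of_sq_eq_neg_one {R : Type*} [CommRing R] {i : R} (hi : i ^ 2 = -1)
    {P : Ideal R} [P.IsPrime] (h : (2 : R) ∈ P) : (2 : R) ∈ P ^ 2 := by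
  have h1 : 1 + i ∈ P := by
    refine Ideal.IsPrime.mem_of_pow_mem ‹_› 2 ?_
    rw [show (1 + i) ^ 2 = 2 * i by linear_combination hi]
    exact Ideal.mul_mem_right _ _ h
  rw [show (2 : R) = (-i) * (1 + i) ^ 2 by linear_combination (i + 2) * hi]
  exact Ideal.mul_mem_left _ _ (Ideal.pow_mem_pow h1 2)

variable {K : IntermediateField ℚ ℂ} [NumberField K] {m p : ℕ}

theorem exists_isPrimitiveRoot_governingField (hm : m ≠ 0) :
    ∃ ζ : 𝓞 (GoverningField K m), IsPrimitiveRoot ζ m := by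
  have hζ := Complex.isPrimitiveRoot_exp m hm
  set z : GoverningField K m := ⟨Complex.exp (2 * Real.pi * Complex.I / m),
    IntermediateField.subset_adjoin _ _ (.inl rfl)⟩
  have hz : IsPrimitiveRoot z m := .of_map_of_injective (f := algebraMap (GoverningField K m) ℂ) hζ
    (algebraMap (GoverningField K m) ℂ).injective
  refine ⟨⟨z, hz.isIntegral hm.bot_lt⟩, .of_map_of_injective
    (f := algebraMap (𝓞 (GoverningField K m)) (GoverningField K m)) hz
    RingOfIntegers.coe_injective⟩

theorem exists_sq_eq_neg_one_governingField : ∃ i : 𝓞 (GoverningField K 2), i ^ 2 = -1 := by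
  have hmem : Complex.I ∈ GoverningField K 2 := by
    refine IntermediateField.subset_adjoin _ _ (.inr ⟨-1, by simp, ⟨1, ?_⟩, by simp⟩)
    rw [one_pow, ← FractionalIdeal.spanSingleton_one]
    refine FractionalIdeal.spanSingleton_eq_spanSingleton.mpr ⟨-1, by simp⟩
  have hi : (⟨Complex.I, hmem⟩ : GoverningField K 2) ^ 2 = -1 := Subtype.ext (by simp)
  refine ⟨⟨⟨Complex.I, hmem⟩, .of_pow two_pos (hi ▸ isIntegral_one.neg)⟩, RingOfIntegers.ext hi⟩

theorem ne_of_splitsCompletelyIn_governingField (hm : m.Prime) {𝔮 : Ideal (𝓞 K)}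
    (h𝔮 : 𝔮.IsPrime) (hp𝔮 : (p : 𝓞 K) ∈ 𝔮)
    (h : SplitsCompletelyIn p (𝓞 (GoverningField K m))) : p ≠ m := by
  rintro rfl
  obtain ⟨P, hP, rfl⟩ := exists_prime_under_eq (S := 𝓞 (GoverningField K p)) 𝔮
  rw [Ideal.mem_comap, map_natCast] at hp𝔮
  refine (h P hP hp𝔮).1 ?_
  by_cases hp2 : p = 2
  · subst hp2
    obtain ⟨i, hi⟩ := exists_sq_eq_neg_one_governingField (K := K)
    exact two_mem_sq_of_sq_eq_neg_one hi hp𝔮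
  · obtain ⟨ζ, hζ⟩ := exists_isPrimitiveRoot_governingField (K := K) hm.ne_zero
    exact hζ.natCast_mem_sq hm hp2 hp𝔮

end Governing

section Compositum

variable {K : IntermediateField ℚ ℂ} {m p : ℕ}

theorem IsCyclicDeg.isAbelianExpM {L : IntermediateField K ℂ} (hm : m ≠ 0)
    (hL : IsCyclicDeg K m L) : IsAbelianExpM K m L := by
  obtain ⟨h₁, h₂, h₃⟩ := hL
  have : FiniteDimensional K L := .of_finrank_pos (h₂ ▸ hm.bot_lt)
  refine ⟨this, h₁, (IsAbelianGalois.of_isCyclic (K := K) (L := L)).is_comm.comm, fun g ↦ ?_⟩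
  have := pow_card_eq_one' (x := g)
  rwa [IsGalois.card_aut_eq_finrank, h₂] at this

theorem mem_Kmp_iff [NumberField K] {L : IntermediateField K ℂ} (hL : IsAbelianExpM K m L)
    (hL' : UnramifiedOutside K p L) {x : ℂ} : x ∈ Kmp K m p ↔
      ∃ F, (IsAbelianExpM K m F ∧ UnramifiedOutside K p F) ∧ L ≤ F ∧ x ∈ F := by
  constructor
  · intro hx
    let S := {L | IsAbelianExpM K m L ∧ UnramifiedOutside K p L}
    have : Nonempty S := ⟨⟨L, hL, hL'⟩⟩
    have hdir : Directed (· ≤ ·) (Subtype.val : S → IntermediateField K ℂ) := fun E F ↦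
      ⟨⟨E ⊔ F, E.2.1.sup F.2.1, .sup E.2.1 F.2.1 E.2.2 F.2.2⟩, le_sup_left, le_sup_right⟩
    rw [Kmp, sSup_eq_iSup', ← SetLike.mem_coe, IntermediateField.coe_iSup_of_directed hdir,
      Set.mem_iUnion] at hx
    obtain ⟨F, hF⟩ := hx
    exact ⟨F ⊔ L, ⟨F.2.1.sup hL, .sup F.2.1 hL F.2.2 hL'⟩, le_sup_right, le_sup_left (a := F.1) hF⟩
  · rintro ⟨F, hF, -, hx⟩
    exact le_sSup (a := F) hF hx

theorem conj_mem_Kmp [NumberField K] {σ : K ≃+* K}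
    (hσ : ∀ x : K, (σ x : ℂ) = (starRingEnd ℂ) x) {L : IntermediateField K ℂ}
    (hL : IsAbelianExpM K m L) (hL' : UnramifiedOutside K p L) {x : ℂ} (hx : x ∈ Kmp K m p) :
    (starRingEnd ℂ) x ∈ Kmp K m p := by
  obtain ⟨F, hF, -, hxF⟩ := (mem_Kmp_iff hL hL').mp hx
  let F' : IntermediateField K ℂ := (F.toSubfield.comap (starRingEnd ℂ)).toIntermediateField
    fun y ↦ by
      change (starRingEnd ℂ) (y : ℂ) ∈ F
      rw [← hσ]
      exact F.algebraMap_mem (σ y)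
  let e : F ≃+* F' :=
    { toFun := fun y ↦ ⟨(starRingEnd ℂ) y, by
        change (starRingEnd ℂ) ((starRingEnd ℂ) (y : ℂ)) ∈ F
        rw [Complex.conj_conj]
        exact y.2⟩
      invFun := fun y ↦ ⟨(starRingEnd ℂ) y, y.2⟩
      left_inv := fun y ↦ Subtype.ext (Complex.conj_conj _)
      right_inv := fun y ↦ Subtype.ext (Complex.conj_conj _)
      map_mul' := fun y z ↦ Subtype.ext (map_mul (starRingEnd ℂ) _ _)
      map_add' := fun y z ↦ Subtype.ext (map_add (starRingEnd ℂ) _ _) }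
  have he : ∀ y : K, e (algebraMap K F y) = algebraMap K F' (σ y) := fun y ↦
    Subtype.ext (hσ y).symm
  have hF' : F' ≤ Kmp K m p := le_sSup ⟨hF.1.of_ringEquiv σ e he, hF.2.of_ringEquiv σ e he⟩
  exact hF' (e ⟨x, hxF⟩).2

end Compositum

/-- **Reduction of the splitting in `K^(m)(p)` to the field `K^(m)(𝔮̄)`** (Lemma 2.6 of
the paper).  Suppose `p` splits completely in the `m`-governing field of `K` and in every
`m`-elementary abelian everywhere-unramified extension of `K`, with `pO_K = 𝔮𝔮̄`,
`𝔮 ≠ 𝔮̄`.  Then for every degree-`m` cyclic extension `L/K` ramified exactly at `𝔮̄`: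
`f(p, K^(m)(p)/ℚ) = 1` iff `f(𝔮, L/K) = 1`. -/
theorem stmt_12 (K : IntermediateField ℚ ℂ) [NumberField ↥K]
    (hdeg : Module.finrank ℚ ↥K = 2) (him : ∃ x : ↥K, ((x : ℂ)).im ≠ 0)
    (m : ℕ) (hm : m.Prime)
    (p : ℕ) (hp : p.Prime)
    (hgov : SplitsCompletelyIn p (𝓞 ↥(GoverningField K m)))
    (hHK : ∀ L : IntermediateField ↥K ℂ, IsAbelianExpM K m L →
      (∀ 𝔮 : Ideal (𝓞 ↥K), 𝔮.IsPrime → 𝔮 ≠ ⊥ → UnramifiedAt K L 𝔮) →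
      SplitsCompletelyIn p (𝓞 ↥L))
    (𝔮 𝔮b : Ideal (𝓞 ↥K)) (h𝔮 : 𝔮.IsPrime) (h𝔮b : 𝔮b.IsPrime) (hne : 𝔮 ≠ 𝔮b)
    (hfac : 𝔮 * 𝔮b = Ideal.span {(p : 𝓞 ↥K)}) :
    ∀ L : IntermediateField ↥K ℂ, IsCyclicDeg K m L → RamifiedExactlyAt K L 𝔮b →
      (ResidueDegreeOneAbove p (𝓞 ↥(Kmp K m p)) ↔
        (∀ P : Ideal (𝓞 ↥L), P.IsPrime → Ideal.map (intMap K L) 𝔮 ≤ P →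
          ∀ y : 𝓞 ↥L ⧸ P, ∃ x : 𝓞 ↥K, Ideal.Quotient.mk P (intMap K L x) = y)) := by
  intro L hL hLram
  have hpmem : (p : 𝓞 K) ∈ 𝔮 * 𝔮b := by
    rw [hfac]
    exact Ideal.mem_span_singleton_self _
  have hp𝔮 : (p : 𝓞 K) ∈ 𝔮 := (Ideal.mul_le_left : 𝔮 * 𝔮b ≤ 𝔮) hpmem
  have hp𝔮b : (p : 𝓞 K) ∈ 𝔮b := (Ideal.mul_le_right : 𝔮 * 𝔮b ≤ 𝔮b) hpmem
  have hLab : IsAbelianExpM K m L := hL.isAbelianExpM hm.ne_zero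
  have hLun : UnramifiedOutside K p L := fun 𝔯 h𝔯 h𝔯₀ hp𝔯 ↦
    hLram.2 𝔯 h𝔯 h𝔯₀ fun h ↦ hp𝔯 (h ▸ hp𝔮b)
  constructor
  · intro h P hP hP' y
    have hle : L ≤ Kmp K m p := le_sSup ⟨hLab, hLun⟩
    let _ : Algebra L (Kmp K m p) := (IntermediateField.inclusion hle).toRingHom.toAlgebra
    have hpP : (p : 𝓞 L) ∈ P := by
      have := hP' (Ideal.mem_map_of_mem (intMap K L) hp𝔮)
      rwa [map_natCast] at this
    obtain ⟨n, hn⟩ := (h.of_isIntegral (R := 𝓞 L)) P hP hpP y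
    exact ⟨n, by rw [map_natCast, map_natCast]; exact hn⟩
  · intro hLres
    have hres : Function.Surjective (fun n : ℕ ↦ (n : 𝓞 K ⧸ 𝔮)) :=
      ResidueDegreeOneAbove.of_isIntegral (𝓞 (GoverningField K m))
        (fun P hP h ↦ (hgov P hP h).2) 𝔮 h𝔮 hp𝔮
    have hpm := ne_of_splitsCompletelyIn_governingField hm h𝔮 hp𝔮 hgov
    have hmain : ∀ Q : Ideal (𝓞 (Kmp K m p)), Q.IsPrime → Q.under (𝓞 K) = 𝔮 →
        ∀ y : 𝓞 (Kmp K m p), ∃ n : ℕ, y - n ∈ Q := by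
      intro Q hQ hQ𝔮 y
      obtain ⟨F, hF, hLF, hyF⟩ := (mem_Kmp_iff hLab hLun).mp (y : Kmp K m p).2
      have hle : F ≤ Kmp K m p := le_sSup hF
      let _ : Algebra F (Kmp K m p) := (IntermediateField.inclusion hle).toRingHom.toAlgebra
      have : IsScalarTower K F (Kmp K m p) := .of_algebraMap_eq' rfl
      have hy : IsIntegral ℤ (⟨y, hyF⟩ : F) :=
        (isIntegral_algHom_iff ((algebraMap F ℂ).toIntAlgHom) (algebraMap F ℂ).injective).mp
          (y.isIntegral_coe.map ((algebraMap (Kmp K m p) ℂ).toIntAlgHom))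
      obtain ⟨z, hz⟩ : ∃ z : 𝓞 F, algebraMap (𝓞 F) (𝓞 (Kmp K m p)) z = y := ⟨⟨⟨y, hyF⟩, hy⟩, rfl⟩
      obtain ⟨n, hn⟩ := exists_sub_natCast_mem.mp (surjective_natCast_of_under_eq hm hp hpm hHK h𝔮
        h𝔮b hne hfac hres hLram hLres hF.1 hF.2 hLF (Q := Q.under (𝓞 F)) inferInstance
        ((Ideal.under_under Q).trans hQ𝔮)) z
      refine ⟨n, ?_⟩
      rwa [Ideal.mem_comap, map_sub, map_natCast, hz] at hn
    intro Q hQ hpQ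
    refine exists_sub_natCast_mem.mpr ?_
    have hpQ' : (p : 𝓞 K) ∈ Q.under (𝓞 K) := by rwa [Ideal.mem_comap, map_natCast]
    rcases eq_or_eq_of_natCast_mem hp h𝔮 h𝔮b hfac inferInstance hpQ' with h | h
    · exact hmain Q hQ h
    · obtain ⟨σ, hσ, hσ𝔮⟩ := exists_conj hdeg him hp h𝔮 h𝔮b hne hp𝔮 hp𝔮b
      let c : Kmp K m p →+* Kmp K m p :=
        ((starRingEnd ℂ).comp (algebraMap (Kmp K m p) ℂ)).codRestrict (Kmp K m p)
          fun x ↦ conj_mem_Kmp hσ hLab hLun x.2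
      let c' : 𝓞 (Kmp K m p) →+* 𝓞 (Kmp K m p) := RingOfIntegers.mapRingHom c
      have hcc : ∀ y, c' (c' y) = y := fun y ↦
        RingOfIntegers.ext (Subtype.ext (Complex.conj_conj _))
      have hcσ : ∀ x : 𝓞 K, c' (algebraMap (𝓞 K) (𝓞 (Kmp K m p)) x) =
          algebraMap (𝓞 K) (𝓞 (Kmp K m p)) (RingOfIntegers.mapRingEquiv σ x) := fun x ↦
        RingOfIntegers.ext (Subtype.ext (hσ x).symm)
      have hunder : (Q.comap c').under (𝓞 K) = 𝔮 := by
        have hmax : 𝔮.IsMaximal := h𝔮.isMaximal fun h0 ↦ by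
          rw [h0, Ideal.mem_bot] at hp𝔮
          exact hp.ne_zero (Nat.cast_eq_zero.mp hp𝔮)
        refine (hmax.eq_of_le (Ideal.IsPrime.ne_top inferInstance) fun x hx ↦ ?_).symm
        rw [Ideal.mem_comap, Ideal.mem_comap, hcσ, ← Ideal.mem_comap]
        exact h.ge (hσ𝔮 x hx)
      intro y
      obtain ⟨n, hn⟩ := hmain (Q.comap c') inferInstance hunder (c' y)
      exact ⟨n, by rwa [Ideal.mem_comap, map_sub, hcc, map_natCast] at hn⟩
end
end

section
/- Let K be a number field and let 𝔭 be a prime ideal of O_K not dividing 3. Let L be a degree-2 extension of K containing a primitive third root of unity ζ, with σ the nontrivial element of Gal(L/K), and suppose 𝔭 splits in L, i.e. 𝔭O_L = 𝔮·σ(𝔮) for a prime ideal 𝔮 ≠ σ(𝔮) of O_L. Then for all α ∈ O_K: if σ(ζ) = ζ (equivalently, ζ ∈ K), then (α/𝔭O_L)_{L,3} = ((α/𝔭)_{K,3})²; if σ(ζ) ≠ ζ, then (α/𝔭O_L)_{L,3} = 1 when α ∉ 𝔭, and (α/𝔭O_L)_{L,3} = 0 when α ∈ 𝔭. -/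
open NumberField

namespace IsCubicResidueSymbol

variable {R : Type*} [CommRing R] {ζ : R} {χ : R → Ideal R → R}

lemma eq_zero_of_mem (hχ : IsCubicResidueSymbol ζ χ) {γ : R} {𝔮 : Ideal R} (h𝔮 : 𝔮.IsPrime)
    (h3 : (3 : R) ∉ 𝔮) (hγ : γ ∈ 𝔮) : χ γ 𝔮 = 0 :=
  (hχ.1 γ 𝔮 h𝔮 h3).1 hγ

lemma sub_pow_mem (hχ : IsCubicResidueSymbol ζ χ) {γ : R} {𝔮 : Ideal R} (h𝔮 : 𝔮.IsPrime)
    (h3 : (3 : R) ∉ 𝔮) (hγ : γ ∉ 𝔮) : χ γ 𝔮 - γ ^ ((Nat.card (R ⧸ 𝔮) - 1) / 3) ∈ 𝔮 :=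
  ((hχ.1 γ 𝔮 h𝔮 h3).2 hγ).2

lemma eq_one_or_eq_or_eq_sq (hχ : IsCubicResidueSymbol ζ χ) {γ : R} {𝔮 : Ideal R}
    (h𝔮 : 𝔮.IsPrime) (h3 : (3 : R) ∉ 𝔮) (hγ : γ ∉ 𝔮) :
    χ γ 𝔮 = 1 ∨ χ γ 𝔮 = ζ ∨ χ γ 𝔮 = ζ ^ 2 :=
  ((hχ.1 γ 𝔮 h𝔮 h3).2 hγ).1

lemma pow_three_eq_one (hχ : IsCubicResidueSymbol ζ χ) (hζ : ζ ^ 3 = 1) {γ : R} {𝔮 : Ideal R}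
    (h𝔮 : 𝔮.IsPrime) (h3 : (3 : R) ∉ 𝔮) (hγ : γ ∉ 𝔮) : χ γ 𝔮 ^ 3 = 1 := by
  rcases hχ.eq_one_or_eq_or_eq_sq h𝔮 h3 hγ with h | h | h <;> rw [h]
  · exact one_pow 3
  · exact hζ
  · rw [← pow_mul, mul_comm, pow_mul, hζ, one_pow]

lemma mul_of_isMaximal (hχ : IsCubicResidueSymbol ζ χ) (γ : R) {𝔮 𝔮' : Ideal R}
    (h𝔮 : 𝔮.IsMaximal) (h𝔮' : 𝔮'.IsMaximal) (h3 : (3 : R) ∉ 𝔮) (h3' : (3 : R) ∉ 𝔮') :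
    χ γ (𝔮 * 𝔮') = χ γ 𝔮 * χ γ 𝔮' := by
  have key {I : Ideal R} (hI : I.IsMaximal) (h : (3 : R) ∉ I) : Ideal.span {(3 : R)} ⊔ I = ⊤ :=
    sup_comm I _ ▸ hI.out.2 _ (left_lt_sup.2 (by simpa [Ideal.span_singleton_le_iff_mem]))
  exact hχ.2.2 γ 𝔮 𝔮' (key h𝔮 h3) (key h𝔮' h3')

end IsCubicResidueSymbol

/-- Third roots of unity in a domain are distinct modulo an ideal not containing `3`. -/
lemma eq_of_pow_three_eq_one_of_sub_mem {R : Type*} [CommRing R] [IsDomain R] {𝔮 : Ideal R}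
    (h3 : (3 : R) ∉ 𝔮) {x y : R} (hx : x ^ 3 = 1) (hy : y ^ 3 = 1)
    (hxy : x - y ∈ 𝔮) : x = y := by
  by_contra hne
  have h : x ^ 2 + x * y + y ^ 2 = 0 := by
    refine (mul_eq_zero.1 ?_).resolve_left (sub_ne_zero.2 hne)
    linear_combination hx - hy
  refine h3 ?_
  have : (3 : R) = -(x * y) ^ 2 * (x - y) * (x - y) := by
    linear_combination (-3 * y ^ 3) * hx - 3 * hy + (x * y) ^ 2 * h
  rw [this]
  exact 𝔮.mul_mem_left _ hxy

/-- In a domain, an endomorphism moving a primitive third root of unity inverts it. -/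
lemma mul_map_eq_one_of_pow_three_eq_one {R : Type*} [CommRing R] [IsDomain R] (s : R →+* R)
    {ζ : R} (hζ3 : ζ ^ 3 = 1) (hs : s ζ ≠ ζ) : ζ * s ζ = 1 := by
  have hζ1 : ζ ≠ 1 := fun h ↦ hs (by rw [h, map_one])
  have h1 : ζ ^ 2 + ζ + 1 = 0 := by
    refine (mul_eq_zero.1 ?_).resolve_left (sub_ne_zero.2 hζ1)
    linear_combination hζ3
  have h2 : s ζ ^ 2 + s ζ + 1 = 0 := by simpa using congrArg s h1
  have h3 : s ζ + ζ + 1 = 0 := by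
    refine (mul_eq_zero.1 ?_).resolve_left (sub_ne_zero.2 hs)
    linear_combination h2 - h1
  linear_combination ζ * h3 - h1

lemma card_quotient_map_ringEquiv {R S : Type*} [CommRing R] [CommRing S] (e : R ≃+* S)
    (I : Ideal R) : Nat.card (S ⧸ I.map (e : R →+* S)) = Nat.card (R ⧸ I) :=
  (Nat.card_congr (Ideal.quotientEquiv I _ e rfl).toEquiv).symm

/-- **Field lowering, split case** (Lemma 3.2 of the paper).  Let `K` be a number field,
`𝔭 ∤ 3` a prime of `O_K`, and `L/K` quadratic with `ζ₃ ∈ L`, `σ` the nontrivial element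
of `Gal(L/K)`, and suppose `𝔭` splits in `L`.  Then for `α ∈ O_K`:
`(α/𝔭O_L)_{L,3} = ((α/𝔭)_{K,3})²` if `σ(ζ₃) = ζ₃`, while if `σ(ζ₃) ≠ ζ₃` the symbol
`(α/𝔭O_L)_{L,3}` equals `1` for `α ∉ 𝔭` and `0` for `α ∈ 𝔭`. -/
theorem stmt_15 (K L : Type*) [Field K] [NumberField K] [Field L] [NumberField L]
    [Algebra K L] (hdim : Module.finrank K L = 2)
    (ζL : 𝓞 L) (hζ3 : ζL ^ 3 = 1) (hζ1 : ζL ≠ 1)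
    (σ : L ≃ₐ[K] L) (hσ : σ ≠ AlgEquiv.refl)
    (𝔭 : Ideal (𝓞 K)) (h𝔭 : 𝔭.IsPrime) (h𝔭3 : (3 : 𝓞 K) ∉ 𝔭)
    (𝔮 : Ideal (𝓞 L)) (h𝔮 : 𝔮.IsPrime)
    (hsplit : Ideal.map (RingOfIntegers.mapRingHom (algebraMap K L)) 𝔭 =
      𝔮 * Ideal.map (RingOfIntegers.mapRingHom σ) 𝔮)
    (hsplitne : 𝔮 ≠ Ideal.map (RingOfIntegers.mapRingHom σ) 𝔮)
    (α : 𝓞 K)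
    (χL : 𝓞 L → Ideal (𝓞 L) → 𝓞 L) (hχL : IsCubicResidueSymbol ζL χL) :
    (σ (ζL : L) = (ζL : L) →
      ∀ ζK : 𝓞 K, RingOfIntegers.mapRingHom (algebraMap K L) ζK = ζL →
      ∀ χK : 𝓞 K → Ideal (𝓞 K) → 𝓞 K, IsCubicResidueSymbol ζK χK →
        χL (RingOfIntegers.mapRingHom (algebraMap K L) α)
            (Ideal.map (RingOfIntegers.mapRingHom (algebraMap K L)) 𝔭) =
          (RingOfIntegers.mapRingHom (algebraMap K L) (χK α 𝔭)) ^ 2) ∧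
    (σ (ζL : L) ≠ (ζL : L) →
      (α ∉ 𝔭 →
        χL (RingOfIntegers.mapRingHom (algebraMap K L) α)
          (Ideal.map (RingOfIntegers.mapRingHom (algebraMap K L)) 𝔭) = 1) ∧
      (α ∈ 𝔭 →
        χL (RingOfIntegers.mapRingHom (algebraMap K L) α)
          (Ideal.map (RingOfIntegers.mapRingHom (algebraMap K L)) 𝔭) = 0)) := by
  have hcard𝔭 := Ideal.absNorm_algebraMap (R := 𝓞 K) (S := 𝓞 L) (I := 𝔭)
  rw [← IsFractionRing.finrank_eq (𝓞 K) K (𝓞 L) L, hdim] at hcard𝔭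
  change Ideal.absNorm (Ideal.map (RingOfIntegers.mapRingHom (algebraMap K L)) 𝔭) = _ at hcard𝔭
  rw [hsplit, map_mul] at hcard𝔭
  rw [hsplit]
  set φ : 𝓞 K →+* 𝓞 L := RingOfIntegers.mapRingHom (algebraMap K L) with hφ
  set s : 𝓞 L →+* 𝓞 L := RingOfIntegers.mapRingHom σ with hs
  have hsφ (x : 𝓞 K) : s (φ x) = φ x := RingOfIntegers.ext (σ.commutes (x : K))
  set 𝔮' := Ideal.map s 𝔮 with h𝔮'def
  have h𝔮'card : Nat.card (𝓞 L ⧸ 𝔮') = Nat.card (𝓞 L ⧸ 𝔮) :=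
    card_quotient_map_ringEquiv (RingOfIntegers.mapRingEquiv (σ : L ≃+* L)) 𝔮
  have h𝔮' : 𝔮'.IsPrime :=
    Ideal.map_isPrime_of_equiv (I := 𝔮) (RingOfIntegers.mapRingEquiv (σ : L ≃+* L))
  have h𝔮card : Nat.card (𝓞 L ⧸ 𝔮) = Nat.card (𝓞 K ⧸ 𝔭) := by
    simp only [Ideal.absNorm_apply, Submodule.cardQuot_apply] at hcard𝔭
    rw [h𝔮'card, ← sq] at hcard𝔭
    exact Nat.pow_left_injective two_ne_zero hcard𝔭
  have hbot : 𝔮 ≠ ⊥ := fun h ↦ hsplitne (by rw [h𝔮'def, h, Ideal.map_bot])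
  have hbot' : 𝔮' ≠ ⊥ := fun h ↦ hbot <|
    (Ideal.map_eq_bot_iff_of_injective (RingOfIntegers.mapRingEquiv (σ : L ≃+* L)).injective).1 h
  have h𝔭bot : 𝔭 ≠ ⊥ := by
    rintro rfl
    rw [Ideal.map_bot] at hsplit
    exact (mul_ne_zero hbot hbot') hsplit.symm
  have h𝔭max := h𝔭.isMaximal h𝔭bot
  have hmem {I : Ideal (𝓞 L)} (hI : I.IsPrime) (hle : Ideal.map φ 𝔭 ≤ I) (x : 𝓞 K) :
      φ x ∈ I ↔ x ∈ 𝔭 := by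
    rw [← Ideal.mem_comap, ← h𝔭max.eq_of_le (Ideal.comap_ne_top φ hI.ne_top)
      (Ideal.map_le_iff_le_comap.1 hle)]
  have hm := hmem h𝔮 (hsplit ▸ Ideal.mul_le_left)
  have hm' := hmem h𝔮' (hsplit ▸ Ideal.mul_le_right)
  have h3 : (3 : 𝓞 L) ∉ 𝔮 := fun h ↦ h𝔭3 ((hm 3).1 (by rwa [map_ofNat]))
  have h3' : (3 : 𝓞 L) ∉ 𝔮' := fun h ↦ h𝔭3 ((hm' 3).1 (by rwa [map_ofNat]))
  rw [hχL.mul_of_isMaximal (φ α) (h𝔮.isMaximal hbot) (h𝔮'.isMaximal hbot') h3 h3']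
  refine ⟨fun _ ζK hζK χK hχK ↦ ?_, fun hσζ ↦ ⟨fun hα ↦ ?_, fun hα ↦ ?_⟩⟩
  · by_cases hα : α ∈ 𝔭
    · rw [hχL.eq_zero_of_mem h𝔮 h3 ((hm α).2 hα), hχK.eq_zero_of_mem h𝔭 h𝔭3 hα]
      simp
    have hζK3 : ζK ^ 3 = 1 := by
      refine RingOfIntegers.ext ((algebraMap K L).injective ?_)
      have := congrArg (fun x : 𝓞 L ↦ (x : L)) ((congrArg (· ^ 3) hζK).trans hζ3)
      simpa [hφ] using this
    have hχ3 : φ (χK α 𝔭) ^ 3 = 1 := by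
      rw [← map_pow, hχK.pow_three_eq_one hζK3 h𝔭 h𝔭3 hα, map_one]
    have key {I : Ideal (𝓞 L)} (hI : I.IsPrime) (hI3 : (3 : 𝓞 L) ∉ I)
        (hmI : ∀ x, φ x ∈ I ↔ x ∈ 𝔭) (hcard : Nat.card (𝓞 L ⧸ I) = Nat.card (𝓞 K ⧸ 𝔭)) :
        χL (φ α) I = φ (χK α 𝔭) := by
      have hαI : φ α ∉ I := fun h ↦ hα ((hmI α).1 h)
      refine eq_of_pow_three_eq_one_of_sub_mem hI3 (hχL.pow_three_eq_one hζ3 hI hI3 hαI) hχ3 ?_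
      have h1 := hχL.sub_pow_mem hI hI3 hαI
      have h2 := (hmI _).2 (hχK.sub_pow_mem h𝔭 h𝔭3 hα)
      rw [map_sub, map_pow, ← hcard] at h2
      simpa using I.sub_mem h1 h2
    rw [key h𝔮 h3 hm h𝔮card, key h𝔮' h3' hm' (h𝔮'card.trans h𝔮card), sq]
  · have hα𝔮 : φ α ∉ 𝔮 := fun h ↦ hα ((hm α).1 h)
    have hα𝔮' : φ α ∉ 𝔮' := fun h ↦ hα ((hm' α).1 h)
    have hsχ : χL (φ α) 𝔮' = s (χL (φ α) 𝔮) := by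
      refine eq_of_pow_three_eq_one_of_sub_mem h3'
        (hχL.pow_three_eq_one hζ3 h𝔮' h3' hα𝔮')
        (by rw [← map_pow, hχL.pow_three_eq_one hζ3 h𝔮 h3 hα𝔮, map_one]) ?_
      have h1 := hχL.sub_pow_mem h𝔮' h3' hα𝔮'
      have h2 := Ideal.mem_map_of_mem s (hχL.sub_pow_mem h𝔮 h3 hα𝔮)
      rw [map_sub, map_pow, hsφ, ← h𝔮'card] at h2
      simpa using 𝔮'.sub_mem h1 h2
    have hζs : ζL * s ζL = 1 := mul_map_eq_one_of_pow_three_eq_one s hζ3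
      fun h ↦ hσζ (congrArg (fun x : 𝓞 L ↦ (x : L)) h)
    rw [hsχ]
    rcases hχL.eq_one_or_eq_or_eq_sq h𝔮 h3 hα𝔮 with h | h | h <;> rw [h]
    · rw [map_one, one_mul]
    · exact hζs
    · rw [map_pow, ← mul_pow, hζs, one_pow]
  · rw [hχL.eq_zero_of_mem h𝔮 h3 ((hm α).2 hα), zero_mul]
end

section
/- Let K be a number field and L a degree-2 extension of K, with σ the nontrivial element of Gal(L/K). Let 𝔭 be a prime ideal of O_K that is unramified in L. Suppose β ∈ O_L satisfies β ≡ σ(β) (mod 𝔭O_L). Then there exists β′ ∈ O_K such that β′ ≡ β (mod 𝔭O_L). -/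
open NumberField

/-- An ideal of a Dedekind domain not contained in the square of a prime is radical. -/
theorem Ideal.mem_of_sq_mem_of_not_le_prime_sq {R : Type*} [CommRing R] [IsDedekindDomain R]
    {I : Ideal R} (hI : ∀ P : Ideal R, P.IsPrime → I ≤ P → ¬ I ≤ P ^ 2) {x : R}
    (hx : x ^ 2 ∈ I) : x ∈ I := by
  have hI0 : I ≠ 0 := by
    rintro rfl
    exact hI ⊥ Ideal.isPrime_bot bot_le bot_le
  have hsq : Squarefree I := by
    intro J hJ
    rw [Ideal.isUnit_iff]
    by_contra hne
    obtain ⟨M, hM, hJM⟩ := Ideal.exists_le_maximal J hne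
    have hle : I ≤ J * J := Ideal.le_of_dvd hJ
    exact hI M hM.isPrime (hle.trans (Ideal.mul_le_left.trans hJM))
      (hle.trans (by rw [sq]; exact Ideal.mul_mono hJM hJM))
  have hrad := (isRadical_iff_squarefree_of_ne_zero hI0).2 hsq
  rw [← Ideal.dvd_span_singleton] at hx ⊢
  rw [← Ideal.span_singleton_pow] at hx
  exact hrad 2 _ hx

/-- In a quadratic extension, a nontrivial automorphism is an involution. -/
theorem AlgEquiv.apply_apply_of_finrank_eq_two {K L : Type*} [Field K] [Field L] [Algebra K L]
    (hdim : Module.finrank K L = 2) {σ : L ≃ₐ[K] L} (hσ : σ ≠ AlgEquiv.refl) (x : L) :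
    σ (σ x) = x := by
  have : FiniteDimensional K L := Module.finite_of_finrank_pos (by omega)
  have hle : Nat.card (L ≃ₐ[K] L) ≤ 2 := by
    rw [Nat.card_eq_fintype_card, ← hdim]
    exact AlgEquiv.card_le
  have : Nontrivial (L ≃ₐ[K] L) := ⟨σ, AlgEquiv.refl, hσ⟩
  have hlt : 1 < Nat.card (L ≃ₐ[K] L) := Finite.one_lt_card
  have hcard : Nat.card (L ≃ₐ[K] L) = 2 := by omega
  have h : σ ^ 2 = 1 := by rw [← hcard]; exact pow_card_eq_one'
  simpa [sq] using DFunLike.congr_fun h x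

/-- In a quadratic extension, the elements fixed by a nontrivial automorphism come from the
base field. -/
theorem AlgEquiv.mem_range_algebraMap_of_finrank_eq_two {K L : Type*} [Field K] [Field L]
    [Algebra K L] (hdim : Module.finrank K L = 2) {σ : L ≃ₐ[K] L} (hσ : σ ≠ AlgEquiv.refl)
    {x : L} (hx : σ x = x) : x ∈ Set.range (algebraMap K L) := by
  have : IsSimpleOrder (IntermediateField K L) :=
    IntermediateField.isSimpleOrder_of_finrank_prime K L (hdim ▸ Nat.prime_two)
  rw [← IntermediateField.mem_bot]
  rcases eq_bot_or_eq_top (IntermediateField.fixedField (Subgroup.zpowers σ)) with h | h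
  · rw [← h, IntermediateField.mem_fixedField_iff]
    intro f hf
    have hle : Subgroup.zpowers σ ≤ MulAction.stabilizer (L ≃ₐ[K] L) x := by
      rw [Subgroup.zpowers_le]
      exact hx
    exact hle hf
  · refine absurd (AlgEquiv.ext fun y ↦ ?_) hσ
    have hy : y ∈ IntermediateField.fixedField (Subgroup.zpowers σ) := h ▸ trivial
    exact (IntermediateField.mem_fixedField_iff _ _).1 hy σ (Subgroup.mem_zpowers σ)

/-- In a quadratic extension of number fields, the integers fixed by a nontrivial automorphism
come from the ring of integers of the base field. -/
theorem NumberField.RingOfIntegers.exists_mapRingHom_eq_of_finrank_eq_two {K L : Type*} [Field K]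
    [Field L] [Algebra K L] (hdim : Module.finrank K L = 2) {σ : L ≃ₐ[K] L}
    (hσ : σ ≠ AlgEquiv.refl) {x : 𝓞 L} (hx : RingOfIntegers.mapRingHom σ x = x) :
    ∃ y : 𝓞 K, RingOfIntegers.mapRingHom (algebraMap K L) y = x := by
  obtain ⟨y, hy⟩ := AlgEquiv.mem_range_algebraMap_of_finrank_eq_two hdim hσ
    (congrArg (fun z : 𝓞 L ↦ (z : L)) hx)
  have hint : IsIntegral ℤ y := by
    rw [← isIntegral_algHom_iff (algebraMap K L).toIntAlgHom (algebraMap K L).injective]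
    exact hy ▸ x.isIntegral_coe
  exact ⟨⟨y, hint⟩, RingOfIntegers.ext hy⟩

/-- **Descending congruence classes** (Lemma 3.4 of the paper).  Let `L/K` be a quadratic
extension of number fields with `σ` the nontrivial element of `Gal(L/K)` and let `𝔭` be a
prime of `O_K` unramified in `L`.  If `β ∈ O_L` satisfies `β ≡ σ(β) (mod 𝔭O_L)`, then
there is `β' ∈ O_K` with `β' ≡ β (mod 𝔭O_L)`. -/
theorem stmt_17 (K L : Type*) [Field K] [NumberField K] [Field L] [NumberField L]
    [Algebra K L] (hdim : Module.finrank K L = 2)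
    (σ : L ≃ₐ[K] L) (hσ : σ ≠ AlgEquiv.refl)
    (𝔭 : Ideal (𝓞 K)) (h𝔭 : 𝔭.IsPrime)
    (hunram : ∀ P : Ideal (𝓞 L), P.IsPrime →
      Ideal.map (RingOfIntegers.mapRingHom (algebraMap K L)) 𝔭 ≤ P →
      ¬ Ideal.map (RingOfIntegers.mapRingHom (algebraMap K L)) 𝔭 ≤ P ^ 2)
    (β : 𝓞 L)
    (hβ : β - RingOfIntegers.mapRingHom σ β ∈
      Ideal.map (RingOfIntegers.mapRingHom (algebraMap K L)) 𝔭) :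
    ∃ β' : 𝓞 K, RingOfIntegers.mapRingHom (algebraMap K L) β' - β ∈
      Ideal.map (RingOfIntegers.mapRingHom (algebraMap K L)) 𝔭 := by
  set φ := RingOfIntegers.mapRingHom (algebraMap K L) with hφ
  set τ := RingOfIntegers.mapRingHom (σ : L →+* L) with hτ
  set I := Ideal.map φ 𝔭
  have hinv : τ (τ β) = β :=
    RingOfIntegers.ext (AlgEquiv.apply_apply_of_finrank_eq_two hdim hσ (β : L))
  have hp0 : 𝔭 ≠ ⊥ := by
    intro h
    refine hunram ⊥ Ideal.isPrime_bot ?_ ?_ <;> simp [I, h]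
  have hmax : 𝔭.IsMaximal := h𝔭.isMaximal hp0
  by_cases h2 : (2 : 𝓞 K) ∈ 𝔭
  · obtain ⟨n, hn⟩ := RingOfIntegers.exists_mapRingHom_eq_of_finrank_eq_two hdim hσ
      (x := β * τ β) (by rw [← hτ, map_mul, hinv, mul_comm])
    obtain ⟨d, hd⟩ : ∃ d : 𝓞 K, n - d ^ 2 ∈ 𝔭 := by
      let := Ideal.Quotient.field 𝔭
      have : Finite (𝓞 K ⧸ 𝔭) := Ideal.finiteQuotientOfFreeOfNeBot 𝔭 hp0
      have : CharP (𝓞 K ⧸ 𝔭) 2 := CharTwo.of_one_ne_zero_of_two_eq_zero one_ne_zero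
        (Ideal.Quotient.eq_zero_iff_mem.2 h2)
      obtain ⟨c, hc⟩ := FiniteField.isSquare_of_char_two
        (ringChar.eq (𝓞 K ⧸ 𝔭) 2) (Ideal.Quotient.mk 𝔭 n)
      obtain ⟨d, rfl⟩ := Ideal.Quotient.mk_surjective c
      exact ⟨d, Ideal.Quotient.eq.1 (by rw [hc, map_pow, sq])⟩
    refine ⟨d, Ideal.mem_of_sq_mem_of_not_le_prime_sq hunram ?_⟩
    have h2I : (2 : 𝓞 L) ∈ I := map_ofNat φ 2 ▸ Ideal.mem_map_of_mem φ h2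
    have hdI : φ n - φ d ^ 2 ∈ I := by simpa using Ideal.mem_map_of_mem φ hd
    have key : (φ d - β) ^ 2 =
        β * (β - τ β) + (φ n - φ d ^ 2) + (φ d ^ 2 - φ d * β) * 2 := by
      rw [hφ, hn]; ring
    rw [key]
    exact I.add_mem (I.add_mem (I.mul_mem_left _ hβ) hdI) (I.mul_mem_left _ h2I)
  · obtain ⟨t, ht⟩ := RingOfIntegers.exists_mapRingHom_eq_of_finrank_eq_two hdim hσ
      (x := β + τ β) (by rw [← hτ, map_add, hinv, add_comm])
    obtain ⟨u, v, hv, huv⟩ := hmax.exists_inv h2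
    have hvI : φ v ∈ I := Ideal.mem_map_of_mem φ hv
    have huv' : φ u * 2 + φ v = 1 := by
      rw [← map_ofNat φ 2, ← map_mul, ← map_add, huv, map_one]
    refine ⟨u * t, ?_⟩
    have key : φ (u * t) - β = -φ u * (β - τ β) + -β * φ v := by
      rw [map_mul, hφ, ht]; linear_combination β * huv'
    rw [key]
    exact I.add_mem (I.mul_mem_left _ hβ) (I.mul_mem_left _ hvI)
end

section
/- Let F be a number field not containing a primitive third root of unity and let L = F(ζ) where ζ is a primitive third root of unity, so [L : F] = 2; let σ be the nontrivial element of Gal(L/F). Let 𝔭 be a prime ideal of O_F not dividing 3 that is unramified in L. Suppose α ∈ O_L satisfies σ(α) ≡ α (mod 𝔭O_L) and α lies in no prime ideal of O_L above 𝔭. Then (α/𝔭O_L)_{L,3} = 1. -/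
open NumberField

/-- Cube roots of unity that are congruent modulo an ideal not containing `3` are equal. -/
theorem eq_of_cube_eq_one_of_sub_mem {R : Type*} [CommRing R] [IsDomain R] {Q : Ideal R}
    (h3 : (3 : R) ∉ Q) {x y : R} (hx : x ^ 3 = 1) (hy : y ^ 3 = 1)
    (hxy : x - y ∈ Q) : x = y := by
  by_contra hne
  have h0 : x ^ 2 + x * y + y ^ 2 = 0 := by
    refine (mul_eq_zero.mp ?_).resolve_left (sub_ne_zero.mpr hne)
    linear_combination hx - hy
  apply h3
  have h : (3 : R) = -(x ^ 2 * y ^ 2 * (x - y)) * (x - y) := by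
    linear_combination (x ^ 2 * y ^ 2) * h0 - 3 * y ^ 3 * hx - 3 * hy
  exact h ▸ Q.mul_mem_left _ hxy

/-- A symbol at an ideal dividing `𝔞` takes values in the cube roots of unity, and is equivariant
under an automorphism `s` which preserves `𝔞` and fixes `α` modulo `𝔞`. -/
theorem IsCubicResidueSymbol.cube_eq_one_and_map {R : Type*} [CommRing R] [IsDedekindDomain R]
    {ζ : R} (hζ : ζ ^ 3 = 1) {χ : R → Ideal R → R} (hχ : IsCubicResidueSymbol ζ χ)
    (s : R ≃+* R) {𝔞 : Ideal R} (h𝔞3 : Ideal.span {(3 : R)} ⊔ 𝔞 = ⊤)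
    (hs : 𝔞.map (s : R →+* R) = 𝔞) {α : R} (hα : s α - α ∈ 𝔞)
    (hα' : ∀ P : Ideal R, P.IsPrime → 𝔞 ≤ P → α ∉ P) (I : Ideal R) (hI0 : I ≠ ⊥) (hI : 𝔞 ≤ I) :
    χ α I ^ 3 = 1 ∧ χ α (I.map (s : R →+* R)) = s (χ α I) := by
  have hcop {J : Ideal R} (hJ : 𝔞 ≤ J) : Ideal.span {(3 : R)} ⊔ J = ⊤ :=
    top_le_iff.mp (h𝔞3 ▸ sup_le_sup_left hJ _)
  have hmap {J : Ideal R} (hJ : 𝔞 ≤ J) : 𝔞 ≤ J.map (s : R →+* R) :=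
    hs.symm.trans_le (Ideal.map_mono hJ)
  have hthree {P : Ideal R} (hP : P.IsPrime) (hle : 𝔞 ≤ P) : (3 : R) ∉ P := fun h ↦
    hP.ne_top <| top_le_iff.mp <| (hcop hle).symm.trans_le <|
      sup_le ((Ideal.span_singleton_le_iff_mem _).mpr h) le_rfl
  have hval {P : Ideal R} (hP : P.IsPrime) (hle : 𝔞 ≤ P) : χ α P ^ 3 = 1 := by
    rcases ((hχ.1 α P hP (hthree hP hle)).2 (hα' P hP hle)).1 with h | h | h <;> rw [h]
    · exact one_pow 3
    · exact hζ
    · rw [pow_right_comm, hζ, one_pow]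
  induction I using UniqueFactorizationMonoid.induction_on_prime with
  | h₁ => exact absurd rfl hI0
  | h₂ J hJ =>
    rw [Ideal.isUnit_iff.mp hJ, Ideal.map_top, hχ.2.1]
    simp
  | h₃ J P hJ0 hP ih =>
    have hPle : 𝔞 ≤ P := hI.trans Ideal.mul_le_left
    have hJle : 𝔞 ≤ J := hI.trans Ideal.mul_le_right
    obtain ⟨hJ1, hJ2⟩ := ih hJ0 hJle
    have hPp : P.IsPrime := Ideal.isPrime_of_prime hP
    have hQp : (P.map (s : R →+* R)).IsPrime := Ideal.map_isPrime_of_equiv s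
    have hQle := hmap hPle
    have hcard : Nat.card (R ⧸ P.map (s : R →+* R)) = Nat.card (R ⧸ P) :=
      (Nat.card_congr (Ideal.quotientEquiv P _ s rfl).toEquiv).symm
    have hP2 : χ α (P.map (s : R →+* R)) = s (χ α P) := by
      refine eq_of_cube_eq_one_of_sub_mem (hthree hQp hQle) (hval hQp hQle)
        (by rw [← map_pow, hval hPp hPle, map_one]) ?_
      have h1 := ((hχ.1 α _ hQp (hthree hQp hQle)).2 (hα' _ hQp hQle)).2
      rw [hcard] at h1
      have h2 := Ideal.mem_map_of_mem (s : R →+* R)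
        ((hχ.1 α P hPp (hthree hPp hPle)).2 (hα' P hPp hPle)).2
      set k := (Nat.card (R ⧸ P) - 1) / 3
      have h3 : s α ^ k - α ^ k ∈ P.map (s : R →+* R) :=
        Ideal.mem_of_dvd _ (sub_dvd_pow_sub_pow _ _ k) (hQle hα)
      simp only [RingHom.coe_coe, map_sub, map_pow] at h2
      convert sub_mem (sub_mem h1 h2) h3 using 1
      ring
    constructor
    · rw [hχ.2.2 α P J (hcop hPle) (hcop hJle), mul_pow, hval hPp hPle, hJ1, one_mul]
    · rw [Ideal.map_mul, hχ.2.2 α P J (hcop hPle) (hcop hJle),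
        hχ.2.2 α _ _ (hcop hQle) (hcop (hmap hJle)), hP2, hJ2, map_mul]

/-- **Triviality of the lowered symbol** (equation (5.1) of the paper, general form).
Let `F` be a number field not containing a primitive third root of unity and
`L = F(ζ₃)`, with `σ` the nontrivial element of `Gal(L/F)`.  Let `𝔭 ∤ 3` be a prime of
`O_F` unramified in `L`.  If `α ∈ O_L` satisfies `σ(α) ≡ α (mod 𝔭O_L)` and `α` avoids
every prime of `O_L` above `𝔭`, then `(α/𝔭O_L)_{L,3} = 1`. -/
theorem stmt_18 (F L : Type*) [Field F] [NumberField F] [Field L] [NumberField L]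
    [Algebra F L]
    (hF : ¬ ∃ z : F, z ^ 3 = 1 ∧ z ≠ 1)
    (ζL : 𝓞 L) (hζ3 : ζL ^ 3 = 1) (hζ1 : ζL ≠ 1)
    (hgen : IntermediateField.adjoin F {(ζL : L)} = ⊤)
    (hdim : Module.finrank F L = 2)
    (σ : L ≃ₐ[F] L) (hσ : σ ≠ AlgEquiv.refl)
    (𝔭 : Ideal (𝓞 F)) (h𝔭 : 𝔭.IsPrime) (h𝔭3 : (3 : 𝓞 F) ∉ 𝔭)
    (hunram : ∀ P : Ideal (𝓞 L), P.IsPrime →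
      Ideal.map (RingOfIntegers.mapRingHom (algebraMap F L)) 𝔭 ≤ P →
      ¬ Ideal.map (RingOfIntegers.mapRingHom (algebraMap F L)) 𝔭 ≤ P ^ 2)
    (α : 𝓞 L)
    (hα : RingOfIntegers.mapRingHom σ α - α ∈
      Ideal.map (RingOfIntegers.mapRingHom (algebraMap F L)) 𝔭)
    (hα' : ∀ P : Ideal (𝓞 L), P.IsPrime →
      Ideal.map (RingOfIntegers.mapRingHom (algebraMap F L)) 𝔭 ≤ P → α ∉ P)
    (χL : 𝓞 L → Ideal (𝓞 L) → 𝓞 L) (hχL : IsCubicResidueSymbol ζL χL) :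
    χL α (Ideal.map (RingOfIntegers.mapRingHom (algebraMap F L)) 𝔭) = 1 := by
  set f := RingOfIntegers.mapRingHom (algebraMap F L)
  let s : 𝓞 L ≃+* 𝓞 L := RingOfIntegers.mapRingEquiv σ
  have hsf : (s : 𝓞 L →+* 𝓞 L).comp f = f := by
    ext x
    exact σ.commutes x
  have hs : (𝔭.map f).map (s : 𝓞 L →+* 𝓞 L) = 𝔭.map f := by rw [Ideal.map_map, hsf]
  have h0 : 𝔭.map f ≠ ⊥ := fun h ↦
    hunram ⊥ Ideal.isPrime_bot h.le (h.trans_le bot_le)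
  have h𝔭0 : 𝔭 ≠ ⊥ := by
    rintro rfl
    exact h0 Ideal.map_bot
  have h3 : Ideal.span {(3 : 𝓞 L)} ⊔ 𝔭.map f = ⊤ := by
    have h : Ideal.span {(3 : 𝓞 F)} ⊔ 𝔭 = ⊤ := by
      rw [sup_comm]
      exact (h𝔭.isMaximal h𝔭0).out.2 _ (left_lt_sup.mpr fun h ↦
        h𝔭3 ((Ideal.span_singleton_le_iff_mem _).mp h))
    simpa [Ideal.map_sup, Ideal.map_span, Ideal.map_top, map_ofNat f 3] using congrArg (Ideal.map f) h
  obtain ⟨hx3, hxs⟩ :=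
    hχL.cube_eq_one_and_map hζ3 s h3 hs hα hα' (𝔭.map f) h0 le_rfl
  rw [hs] at hxs
  generalize χL α (𝔭.map f) = x at hx3 hxs
  by_contra hx1
  have hζx : ζL = x ∨ ζL = x ^ 2 := by
    have hx : x ^ 2 + x + 1 = 0 :=
      (mul_eq_zero.mp (by linear_combination hx3)).resolve_left (sub_ne_zero.mpr hx1)
    have hz : ζL ^ 2 + ζL + 1 = 0 :=
      (mul_eq_zero.mp (by linear_combination hζ3)).resolve_left (sub_ne_zero.mpr hζ1)
    have h : (ζL - x) * (ζL - x ^ 2) = 0 := by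
      linear_combination hz - ζL * hx + hx3
    exact (mul_eq_zero.mp h).imp sub_eq_zero.mp sub_eq_zero.mp
  have hζs : s ζL = ζL := by
    rcases hζx with h | h <;> simp [h, ← hxs]
  have hσζ : σ (ζL : L) = ζL := congrArg ((↑) : 𝓞 L → L) hζs
  apply hσ
  have h : (σ : L →ₐ[F] L) = AlgHom.id F L :=
    AlgHom.ext_of_adjoin_eq_top (IntermediateField.adjoin_eq_top_iff.mp hgen) (by simpa using hσζ)
  ext y
  exact DFunLike.congr_fun h y
end
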